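/- arXiv:2208.01410 — 11 statements merged into one kernel-verified Lean document; each statement's English description precedes it below -/
import Mathlib

section
/- Let N, λ, t, m, s, v be positive integers with s+1 ≤ t ≤ m(s+1). If an ordered covering array OCA_λ(N;t,m,s+1,v) exists, then an ordered covering array OCA_λ(N;t,m,s,v) exists. -/
/-- An anti-ideal of the NRT poset `[m·s]`, whose elements are pairs
`(i, a) : Fin m × Fin s` (block `i`, position `a` within the block, positions
within a block forming a chain): an anti-ideal is an up-closed subset. -/
def IsAntiIdeal (m s : ℕ) (J : Finset (Fin m × Fin s)) : Prop :=
  ∀ i : Fin m, ∀ a b : Fin s, a ≤ b → (i, a) ∈ J → (i, b) ∈ J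

/-- Existence of an ordered covering array `OCA_λ(N; t, m, s, v)`:
an `N × ms` array over an alphabet of size `v`, columns indexed by the NRT poset
`[m·s]`, such that for every anti-ideal `J` of size `t`, every `t`-tuple appears
at least `lam` times as a row of the subarray given by the columns in `J`. -/
def IsOCA (lam N t m s v : ℕ) : Prop :=
  ∃ A : Fin N → Fin m × Fin s → Fin v,
    ∀ J : Finset (Fin m × Fin s), IsAntiIdeal m s J → J.card = t →
      ∀ f : Fin m × Fin s → Fin v,
        lam ≤ (Finset.univ.filter (fun r : Fin N => ∀ c ∈ J, A r c = f c)).card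

/-- The ordered covering array number `OCAN_λ(t, m, s, v)`. -/
noncomputable def OCAN (lam t m s v : ℕ) : ℕ := sInf {N | IsOCA lam N t m s v}

/-- Shifting every block of `[m·s]` up by one position embeds it in `[m·(s+1)]`. -/
def blockShift (m s : ℕ) : Fin m × Fin s ↪ Fin m × Fin (s + 1) :=
  (Function.Embedding.refl _).prodMap (Fin.succEmb s)

@[simp]
theorem blockShift_apply {m s : ℕ} (c : Fin m × Fin s) :
    blockShift m s c = (c.1, c.2.succ) := rfl

theorem IsAntiIdeal.map_blockShift {m s : ℕ} {J : Finset (Fin m × Fin s)}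
    (hJ : IsAntiIdeal m s J) : IsAntiIdeal m (s + 1) (J.map (blockShift m s)) := by
  intro i a b hab ha
  obtain ⟨⟨j, c⟩, hc, hca⟩ := Finset.mem_map.1 ha
  obtain ⟨rfl, rfl⟩ := Prod.mk.inj hca
  obtain ⟨d, rfl⟩ := Fin.exists_succ_eq.2 (Fin.ne_zero_of_lt ((Fin.succ_pos c).trans_le hab))
  exact Finset.mem_map.2 ⟨(j, d), hJ j c d (Fin.succ_le_succ_iff.1 hab) hc, rfl⟩

/-- If an `OCA_λ(N; t, m, s+1, v)` exists then an `OCA_λ(N; t, m, s, v)` exists. -/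
theorem stmt_1 (N lam t m s v : ℕ) (hN : 1 ≤ N) (hlam : 1 ≤ lam) (hv : 1 ≤ v)
    (hm : 1 ≤ m) (hs : 1 ≤ s) (hst : s + 1 ≤ t) (htm : t ≤ m * (s + 1))
    (h : IsOCA lam N t m (s + 1) v) : IsOCA lam N t m s v := by
  obtain ⟨A, hA⟩ := h
  refine ⟨fun r c => A r (blockShift m s c), fun J hJ hcard f => ?_⟩
  have key := hA (J.map (blockShift m s)) hJ.map_blockShift (by rw [Finset.card_map, hcard])
    (fun c => Fin.cases ⟨0, hv⟩ (fun a => f (c.1, a)) c.2)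
  refine key.trans_eq (congrArg Finset.card (Finset.filter_congr fun r _ => ?_))
  simp only [Finset.forall_mem_map, blockShift_apply, Fin.cases_succ]
end

section
/- For all positive integers λ, v and m with m ≥ 2, the ordered covering array number of strength 2 over the NRT poset [m·2] equals the covering array number of strength 2 with m columns: OCAN_λ(2,m,2,v) = CAN_λ(2,m,v). -/
/-- Existence of a covering array `CA_λ(N; t, n, v)`: an `N × n` array over an
alphabet of size `v` such that every set of `t` columns is `λ`-covered. -/
def IsCA (lam N t n v : ℕ) : Prop :=
  ∃ A : Fin N → Fin n → Fin v,
    ∀ J : Finset (Fin n), J.card = t →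
      ∀ f : Fin n → Fin v,
        lam ≤ (Finset.univ.filter (fun r : Fin N => ∀ c ∈ J, A r c = f c)).card

/-- The covering array number `CAN_λ(t, n, v)`. -/
noncomputable def CAN (lam t n v : ℕ) : ℕ := sInf {N | IsCA lam N t n v}

/-- The top columns of the blocks of an ordered covering array form a covering array. -/
theorem IsOCA.isCA {lam N t m s v : ℕ} (hs : 0 < s) (h : IsOCA lam N t m s v) :
    IsCA lam N t m v := by
  obtain ⟨A, hA⟩ := h
  let top : Fin s := ⟨s - 1, by omega⟩
  refine ⟨fun r i => A r (i, top), fun J hJ f => ?_⟩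
  have hcard : (J.image fun i => (i, top)).card = t := by
    rw [Finset.card_image_of_injective _ (Prod.mk_left_injective top), hJ]
  have hanti : IsAntiIdeal m s (J.image fun i => (i, top)) := by
    intro i a b hab ha
    simp only [Finset.mem_image, Prod.mk.injEq] at ha ⊢
    obtain ⟨j, hj, rfl, rfl⟩ := ha
    refine ⟨j, hj, rfl, le_antisymm hab ?_⟩
    have := b.isLt
    simp only [top, Fin.le_def]
    omega
  simpa using hA _ hanti hcard fun c => f c.1

/-- A map from columns of the ordered array to columns of the plain one which is injective on
every anti-ideal of size `t` pulls a covering array back to an ordered covering array. -/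
theorem IsCA.isOCA_of_injOn {lam N t m s n v : ℕ} (ht₀ : 0 < t) (h : IsCA lam N t n v)
    (g : Fin m × Fin s → Fin n)
    (hg : ∀ J : Finset (Fin m × Fin s), IsAntiIdeal m s J → J.card = t → Set.InjOn g J) :
    IsOCA lam N t m s v := by
  obtain ⟨A, hA⟩ := h
  refine ⟨fun r c => A r (g c), fun J hJ ht f => ?_⟩
  have hinj := hg J hJ ht
  obtain ⟨c₀, -⟩ : J.Nonempty := Finset.card_pos.mp (ht ▸ ht₀)
  have : Nonempty (Fin m × Fin s) := ⟨c₀⟩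
  refine (hA (J.image g) (by rw [Finset.card_image_of_injOn hinj, ht])
    (f ∘ Function.invFunOn g J)).trans_eq ?_
  congr 1
  ext r
  simp only [Finset.mem_filter, Finset.mem_univ, true_and, Finset.forall_mem_image,
    Function.comp_apply]
  refine forall₂_congr fun c hc => ?_
  rw [hinj.leftInvOn_invFunOn hc]

/-- Using the top column of another block as the bottom column of each block turns a covering array
of strength two into an ordered one. -/
theorem IsCA.isOCA_two {lam N m v : ℕ} (hm : 2 ≤ m) (h : IsCA lam N 2 m v) :
    IsOCA lam N 2 m 2 v := by
  have : Nontrivial (Fin m) := Fin.nontrivial_iff_two_le.mpr hm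
  choose p hp using fun i : Fin m => exists_ne i
  refine h.isOCA_of_injOn two_pos (fun c => if c.2 = 0 then p c.1 else c.1) fun J hJ hcard => ?_
  by_cases hbot : ∃ i, (i, 0) ∈ J
  · obtain ⟨i, hi⟩ := hbot
    have hi' : (i, 1) ∈ J := hJ i 0 1 (by decide) hi
    have hJ_eq : {(i, 0), (i, 1)} = J :=
      Finset.eq_of_subset_of_card_le (by simp [Finset.insert_subset_iff, hi, hi'])
        (by rw [hcard, Finset.card_pair (by simp)])
    subst hJ_eq
    simp [Set.InjOn, hp i, (hp i).symm]
  · have htop : ∀ c ∈ J, c.2 = 1 := by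
      rintro ⟨i, a⟩ hc
      fin_cases a
      · exact absurd ⟨i, hc⟩ hbot
      · rfl
    intro c hc d hd hcd
    have hc' := htop c hc
    have hd' := htop d hd
    simp only [hc', hd', one_ne_zero, if_false] at hcd
    exact Prod.ext hcd (hc'.trans hd'.symm)

/-- `OCAN_λ(2, m, 2, v) = CAN_λ(2, m, v)` for `m ≥ 2`. -/
theorem stmt_3 (lam m v : ℕ) (hlam : 1 ≤ lam) (hv : 1 ≤ v) (hm : 2 ≤ m) :
    OCAN lam 2 m 2 v = CAN lam 2 m v := by
  unfold OCAN CAN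
  congr 1
  ext N
  exact ⟨IsOCA.isCA two_pos, IsCA.isOCA_two hm⟩
end

section
/- Let v be a prime power with v ≥ 3 and let t ≥ 3 be an integer. Then OCAN(t, v+1, t, v−1) ≤ v^t − 2, i.e., there exists an ordered covering array of strength t over the NRT poset [(v+1)·t] on an alphabet of size v−1 with at most v^t − 2 rows. -/
open Polynomial in
/-- For a point `α` of the projective line over `F` (with `none` the point at infinity), the
`j`-th Taylor coefficient at `α` of a polynomial regarded as having formal degree `t - 1`. -/
noncomputable def localCoeff {F : Type*} [Field F] (t : ℕ) : Option F → ℕ → F[X] →ₗ[F] F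
  | none, j => lcoeff F (t - 1 - j)
  | some α, j => lcoeff F j ∘ₗ taylor α

open Polynomial in
/-- A polynomial of formal degree `t - 1` with at least `t` zeros on the projective line,
counted with multiplicity, is zero. -/
theorem eq_zero_of_localCoeff_eq_zero {F : Type*} [Field F] [Fintype F] {t : ℕ}
    (k : Option F → ℕ) (hk : ∑ o, k o = t) {p : F[X]} (hp : p ∈ degreeLT F t)
    (h : ∀ o, ∀ j < k o, localCoeff t o j p = 0) : p = 0 := by
  rw [Fintype.sum_option] at hk
  have hdvd : ∏ α : F, (X - C α) ^ k (some α) ∣ p := by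
    refine Fintype.prod_dvd_of_coprime (fun a b hab => ?_) fun α => ?_
    · exact (pairwise_coprime_X_sub_C Function.injective_id hab).pow
    · have hX : X ^ k (some α) ∣ taylor α p :=
        X_pow_dvd_iff.2 fun d hd => h (some α) d hd
      obtain ⟨q, hq⟩ := hX
      refine ⟨taylor (-α) q, taylor_injective α ?_⟩
      rw [hq, taylor_mul, taylor_taylor, taylor_pow]
      simp
  have hmonic : (∏ α : F, (X - C α) ^ k (some α)).Monic :=
    monic_prod_of_monic _ _ fun α _ => (monic_X_sub_C α).pow _
  have hdeg : (∏ α : F, (X - C α) ^ k (some α)).natDegree = ∑ α : F, k (some α) := by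
    rw [natDegree_prod_of_monic _ _ fun α _ => (monic_X_sub_C α).pow _]
    simp
  refine eq_zero_of_dvd_of_degree_lt hdvd ?_
  rw [degree_eq_natDegree hmonic.ne_zero, hdeg, degree_lt_iff_coeff_zero]
  intro n hn
  by_cases hnt : t ≤ n
  · exact (degree_lt_iff_coeff_zero p t).1 (mem_degreeLT.1 hp) n hnt
  · have := h none (t - 1 - n) (by omega)
    rwa [localCoeff, lcoeff_apply, show t - 1 - (t - 1 - n) = n by omega] at this

/-- An anti-ideal contains the top `k` elements of a block in which it has `k` elements. -/
theorem IsAntiIdeal.mem_of_rev_lt {m s : ℕ} {J : Finset (Fin m × Fin s)}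
    (hJ : IsAntiIdeal m s J) {i : Fin m} {b : Fin s}
    (hb : (b.rev : ℕ) < (J.filter fun c => c.1 = i).card) : (i, b) ∈ J := by
  by_contra hmem
  have hsub : J.filter (fun c => c.1 = i) ⊆ (Finset.Ioi b).image fun a => (i, a) := by
    rintro ⟨i', a⟩ hc
    obtain ⟨hmemJ, rfl⟩ := Finset.mem_filter.1 hc
    refine Finset.mem_image.2 ⟨a, Finset.mem_Ioi.2 ?_, rfl⟩
    exact lt_of_not_ge fun hab => hmem (hJ _ _ _ hab hmemJ)
  have hcard := (Finset.card_le_card hsub).trans Finset.card_image_le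
  rw [Fin.card_Ioi] at hcard
  rw [Fin.val_rev] at hb
  omega

/-- An ordered covering array of index one may be given with arbitrary finite types of rows
and symbols. -/
theorem isOCA_one_of_fintype {R K : Type*} [Fintype R] [Fintype K] {t m s : ℕ}
    (A : R → Fin m × Fin s → K)
    (hA : ∀ J, IsAntiIdeal m s J → J.card = t → ∀ f : Fin m × Fin s → K,
      ∃ r, ∀ c ∈ J, A r c = f c) :
    IsOCA 1 (Fintype.card R) t m s (Fintype.card K) := by
  refine ⟨fun r c => Fintype.equivFin K (A ((Fintype.equivFin R).symm r) c),
    fun J hJ hcard f => ?_⟩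
  obtain ⟨r, hr⟩ := hA J hJ hcard fun c => (Fintype.equivFin K).symm (f c)
  refine Finset.card_pos.2 ⟨Fintype.equivFin R r, ?_⟩
  simpa [← Equiv.eq_symm_apply] using hr

open Polynomial in
/-- The ordered orthogonal array of strength `t` formed by the Taylor coefficients of the
polynomials of degree less than `t` at all points of the projective line over `F`. -/
theorem isOCA_one_card_pow (F : Type*) [Field F] [Fintype F] (t : ℕ) :
    IsOCA 1 (Fintype.card F ^ t) t (Fintype.card F + 1) t (Fintype.card F) := by
  classical
  let e : Fin (Fintype.card F + 1) ≃ Option F :=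
    (Fintype.equivFinOfCardEq Fintype.card_option).symm
  let L (c : Fin (Fintype.card F + 1) × Fin t) : (Fin t → F) →ₗ[F] F :=
    localCoeff t (e c.1) c.2.rev ∘ₗ (degreeLT F t).subtype ∘ₗ (degreeLTEquiv F t).symm.toLinearMap
  have key := isOCA_one_of_fintype (t := t) (fun x c => L c x) ?_
  · simpa using key
  intro J hJ hcard f
  let M : (Fin t → F) →ₗ[F] (J → F) := LinearMap.pi fun c => L c
  have hinj : Function.Injective M := by
    rw [← LinearMap.ker_eq_bot, LinearMap.ker_eq_bot']
    intro x hx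
    have hp : ((degreeLTEquiv F t).symm x : F[X]) = 0 := by
      refine eq_zero_of_localCoeff_eq_zero (t := t)
        (fun o => (J.filter fun c => c.1 = e.symm o).card) ?_
        ((degreeLTEquiv F t).symm x).2 fun o j hj => ?_
      · rw [Equiv.sum_comp e.symm fun i => (J.filter fun c => c.1 = i).card]
        exact (Finset.card_eq_sum_card_fiberwise fun _ _ =>
          Finset.mem_coe.2 (Finset.mem_univ _)).symm.trans hcard
      · have hjt : j < t := hj.trans_le ((Finset.card_filter_le _ _).trans_eq hcard)
        have hmem : (e.symm o, (⟨j, hjt⟩ : Fin t).rev) ∈ J :=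
          hJ.mem_of_rev_lt (by simpa only [Fin.rev_rev] using hj)
        simpa only [M, L, LinearMap.pi_apply, LinearMap.comp_apply, Equiv.apply_symm_apply,
          Fin.rev_rev, Submodule.subtype_apply, LinearEquiv.coe_coe, Pi.zero_apply] using
          congrFun hx ⟨_, hmem⟩
    simpa using hp
  have hsurj : Function.Surjective M :=
    (LinearMap.injective_iff_surjective_of_finrank_eq_finrank (by simp [hcard])).1 hinj
  obtain ⟨x, hx⟩ := hsurj fun c => f c
  exact ⟨x, fun c hc => congrFun hx ⟨c, hc⟩⟩

/-- Fusion: identifying one symbol per column with the others removes two rows. -/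
theorem IsOCA.fusion {N t m s v : ℕ} (ht : 2 ≤ t) (hv : 0 < v)
    (h : IsOCA 1 (N + 2) t m s (v + 1)) : IsOCA 1 N t m s v := by
  classical
  obtain ⟨A₀, hA₀⟩ := h
  obtain ⟨A, hlast, hA⟩ : ∃ A : Fin (N + 2) → Fin m × Fin s → Fin (v + 1),
      (∀ c, A (Fin.last _) c = Fin.last v) ∧
      ∀ J, IsAntiIdeal m s J → J.card = t → ∀ f : Fin m × Fin s → Fin (v + 1),
        ∃ r, ∀ c ∈ J, A r c = f c := by
    let σ (c : Fin m × Fin s) := Equiv.swap (A₀ (Fin.last _) c) (Fin.last v)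
    refine ⟨fun r c => σ c (A₀ r c), fun c => Equiv.swap_apply_left _ _, fun J hJ hcard f => ?_⟩
    obtain ⟨r, hr⟩ := Finset.card_pos.1 (hA₀ J hJ hcard fun c => (σ c).symm (f c))
    exact ⟨r, fun c hc => (Equiv.eq_symm_apply _).1 ((Finset.mem_filter.1 hr).2 c hc)⟩
  let fuse (x : Fin (v + 1)) (y : Fin v) : Fin v := Fin.lastCases y id x
  let r₂ : Fin (N + 2) := (Fin.last N).castSucc
  refine ⟨fun r c => fuse (A r.castSucc.castSucc c) (fuse (A r₂ c) ⟨0, hv⟩),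
    fun J hJ hcard f => ?_⟩
  suffices hex : ∃ r : Fin N, ∀ c ∈ J,
      fuse (A r.castSucc.castSucc c) (fuse (A r₂ c) ⟨0, hv⟩) = f c by
    obtain ⟨r, hr⟩ := hex
    exact Finset.card_pos.2 ⟨r, by simpa using hr⟩
  obtain ⟨c₀, hc₀, c₁, hc₁, hne⟩ := Finset.one_lt_card.1 (show 1 < J.card by omega)
  obtain ⟨r, hr⟩ := hA J hJ hcard fun c => (f c).castSucc
  induction r using Fin.lastCases with
  | last => exact absurd ((hlast c₀).symm.trans (hr c₀ hc₀)) (Fin.castSucc_lt_last _).ne'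
  | cast r =>
    induction r using Fin.lastCases with
    | cast r => exact ⟨r, fun c hc => by simp [fuse, hr c hc]⟩
    | last =>
      obtain ⟨r', hr'⟩ := hA J hJ hcard
        (Function.update (fun c => (f c).castSucc) c₀ (Fin.last v))
      have h₀ : A r' c₀ = Fin.last v := by simpa using hr' c₀ hc₀
      have h₁ : ∀ c ∈ J, c ≠ c₀ → A r' c = (f c).castSucc := fun c hc hcc => by
        simpa [hcc] using hr' c hc
      induction r' using Fin.lastCases with
      | last =>
        exact absurd ((hlast c₁).symm.trans (h₁ c₁ hc₁ hne.symm)) (Fin.castSucc_lt_last _).ne'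
      | cast r' =>
        induction r' using Fin.lastCases with
        | last => exact absurd (h₀.symm.trans (hr c₀ hc₀)) (Fin.castSucc_lt_last _).ne'
        | cast r' =>
          refine ⟨r', fun c hc => ?_⟩
          by_cases hcc : c = c₀
          · subst hcc
            simp [fuse, h₀, r₂, hr c hc]
          · simp [fuse, h₁ c hc hcc]

/-- For `v` a prime power, `v ≥ 3`, `t ≥ 3`:
`OCAN(t, v+1, t, v-1) ≤ v^t - 2`. -/
theorem stmt_5 (v t : ℕ) (hv : IsPrimePow v) (hv3 : 3 ≤ v) (ht : 3 ≤ t) :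
    OCAN 1 t (v + 1) t (v - 1) ≤ v ^ t - 2 := by
  obtain ⟨p, k, hp, hk, rfl⟩ := hv
  have : Fact p.Prime := ⟨hp.nat_prime⟩
  have := Fintype.ofFinite (GaloisField p k)
  have hcard : Fintype.card (GaloisField p k) = p ^ k := by
    rw [← Nat.card_eq_fintype_card, GaloisField.card p k hk.ne']
  have hO := isOCA_one_card_pow (GaloisField p k) t
  rw [hcard] at hO
  generalize p ^ k = v at hO hv3 ⊢
  have hN : v ≤ v ^ t := Nat.le_self_pow (by omega) v
  refine Nat.sInf_le (IsOCA.fusion (by omega) (by omega) ?_)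
  rwa [Nat.sub_add_cancel (by omega : 2 ≤ v ^ t), Nat.sub_add_cancel (by omega : 1 ≤ v)]
end

section
/- (Alphabet augmentation) For all integers m ≥ 3 and v ≥ 3, OCAN(3,m,3,v) ≤ OCAN(3,m,2,v−1) + m·CAN(2,m−1,v−1) + CAN(2,m,v−1) + m(v−1)² + 1. -/
theorem IsOCA.of_fintype {ι α : Type*} [Fintype ι] [Fintype α] {t m s : ℕ}
    (A : ι → Fin m × Fin s → α)
    (hA : ∀ J : Finset (Fin m × Fin s), IsAntiIdeal m s J → J.card = t →
      ∀ f : Fin m × Fin s → α, ∃ r, ∀ c ∈ J, A r c = f c) :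
    IsOCA 1 (Fintype.card ι) t m s (Fintype.card α) := by
  refine ⟨fun r c => Fintype.equivFin α (A ((Fintype.equivFin ι).symm r) c), fun J hJ ht f => ?_⟩
  obtain ⟨r, hr⟩ := hA J hJ ht fun c => (Fintype.equivFin α).symm (f c)
  refine Finset.card_pos.2 ⟨Fintype.equivFin ι r, ?_⟩
  simp only [Finset.mem_filter, Finset.mem_univ, true_and]
  intro c hc
  simp [hr c hc]

theorem isOCA_OCAN (t m s v : ℕ) : IsOCA 1 (OCAN 1 t m s v) t m s v := by
  have h := IsOCA.of_fintype (t := t) (fun (r : Fin m × Fin s → Fin v) c => r c)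
    fun J _ _ f => ⟨f, fun _ _ => rfl⟩
  rw [Fintype.card_fin] at h
  exact Nat.sInf_mem (s := {N | IsOCA 1 N t m s v}) ⟨_, h⟩

theorem isCA_CAN (t n v : ℕ) : IsCA 1 (CAN 1 t n v) t n v := by
  refine Nat.sInf_mem (s := {N | IsCA 1 N t n v}) ⟨Fintype.card (Fin n → Fin v),
    fun r => (Fintype.equivFin (Fin n → Fin v)).symm r, fun J _ f => ?_⟩
  refine Finset.card_pos.2 ⟨Fintype.equivFin _ f, ?_⟩
  simp

theorem IsCA.exists_pairs {N n v : ℕ} (h : IsCA 1 N 2 n v) :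
    ∃ A : Fin N → Fin n → Fin v, ∀ i j, i ≠ j → ∀ x y, ∃ r, A r i = x ∧ A r j = y := by
  obtain ⟨A, hA⟩ := h
  refine ⟨A, fun i j hij x y => ?_⟩
  obtain ⟨r, hr⟩ := Finset.card_pos.1
    (hA {i, j} (Finset.card_pair hij) (fun k => if k = i then x else y))
  simp only [Finset.mem_filter, Finset.mem_univ, true_and, Finset.mem_insert,
    Finset.mem_singleton, forall_eq_or_imp, forall_eq] at hr
  exact ⟨r, by simpa using hr.1, by simpa [hij.symm] using hr.2⟩

/-- `top r i` and `sec r i` are the entries of row `r` in the two largest columns of block `i`: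
every three top columns are covered, and so are the two largest columns of a block
together with the top column of another block. -/
def CoversTopSec {ι α : Type*} {m : ℕ} (top sec : ι → Fin m → α) : Prop :=
  (∀ i j k, i ≠ j → i ≠ k → j ≠ k → ∀ x y z, ∃ r, top r i = x ∧ top r j = y ∧ top r k = z) ∧
  ∀ i j, i ≠ j → ∀ x y z, ∃ r, top r i = x ∧ sec r i = y ∧ top r j = z

theorem IsOCA.exists_coversTopSec {N m v : ℕ} (h : IsOCA 1 N 3 m 2 v) :
    ∃ top sec : Fin N → Fin m → Fin v, CoversTopSec top sec := by
  obtain ⟨A, hA⟩ := h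
  refine ⟨fun r i => A r (i, 1), fun r i => A r (i, 0), ?_, ?_⟩
  · intro i j k hij hik hjk x y z
    obtain ⟨r, hr⟩ := Finset.card_pos.1 (hA {(i, 1), (j, 1), (k, 1)}
      (by
        intro l a b hab hl
        simp only [Finset.mem_insert, Finset.mem_singleton, Prod.mk.injEq] at hl ⊢
        have : a = 1 → b = 1 := by omega
        tauto)
      (Finset.card_eq_three.2 ⟨_, _, _, by simpa, by simpa, by simpa, rfl⟩)
      (fun c => if c.1 = i then x else if c.1 = j then y else z))
    simp only [Finset.mem_filter, Finset.mem_univ, true_and, Finset.mem_insert,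
      Finset.mem_singleton, forall_eq_or_imp, forall_eq] at hr
    exact ⟨r, by simpa using hr.1, by simpa [hij.symm] using hr.2.1,
      by simpa [hik.symm, hjk.symm] using hr.2.2⟩
  · intro i j hij x y z
    obtain ⟨r, hr⟩ := Finset.card_pos.1 (hA {(i, 1), (i, 0), (j, 1)}
      (by
        intro l a b hab hl
        simp only [Finset.mem_insert, Finset.mem_singleton, Prod.mk.injEq] at hl ⊢
        have h1 : a = 1 → b = 1 := by omega
        have h0 : b = 0 ∨ b = 1 := by omega
        tauto)
      (Finset.card_eq_three.2 ⟨_, _, _, by simp, by simpa, by simp, rfl⟩)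
      (fun c => if c.1 = j then z else if c.2 = 1 then x else y))
    simp only [Finset.mem_filter, Finset.mem_univ, true_and, Finset.mem_insert,
      Finset.mem_singleton, forall_eq_or_imp, forall_eq] at hr
    exact ⟨r, by simpa [hij] using hr.1, by simpa [hij] using hr.2.1, by simpa using hr.2.2⟩

theorem IsAntiIdeal.subset_of_card_eq_three {m : ℕ} {J : Finset (Fin m × Fin 3)}
    (hJ : IsAntiIdeal m 3 J) (h3 : J.card = 3) :
    (∃ i j k, i ≠ j ∧ i ≠ k ∧ j ≠ k ∧ J ⊆ {(i, 2), (j, 2), (k, 2)}) ∨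
    (∃ i j, i ≠ j ∧ J ⊆ {(i, 2), (i, 1), (j, 2)}) ∨
    ∃ i, J ⊆ {(i, 2), (i, 1), (i, 0)} := by
  by_cases h0 : ∃ i, (i, 0) ∈ J
  · obtain ⟨i, hi⟩ := h0
    have h1 := hJ i 0 1 (by decide) hi
    have h2 := hJ i 0 2 (by decide) hi
    refine Or.inr (Or.inr ⟨i, (Finset.eq_of_subset_of_card_le ?_ ?_).ge⟩)
    · simp [Finset.insert_subset_iff, *]
    · rw [h3, Finset.card_eq_three.2 ⟨_, _, _, by simp, by simp, by simp, rfl⟩]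
  push Not at h0
  by_cases h1 : ∃ i, (i, 1) ∈ J
  · obtain ⟨i, hi1⟩ := h1
    have hi2 := hJ i 1 2 (by decide) hi1
    obtain ⟨⟨j, p⟩, hj, hjn⟩ := Finset.exists_mem_notMem_of_card_lt_card
      (s := {(i, 1), (i, 2)}) (t := J) (by rw [h3, Finset.card_pair (by simp)]; decide)
    have hj2 : (j, 2) ∈ J := hJ j p 2 (by omega) hj
    have hij : i ≠ j := by
      rintro rfl
      have hp : p = 0 ∨ p = 1 ∨ p = 2 := by omega
      rcases hp with rfl | rfl | rfl <;> simp_all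
    refine Or.inr (Or.inl ⟨i, j, hij, (Finset.eq_of_subset_of_card_le ?_ ?_).ge⟩)
    · simp [Finset.insert_subset_iff, *]
    · rw [h3, Finset.card_eq_three.2 ⟨_, _, _, by simp, by simpa, by simp, rfl⟩]
  push Not at h1
  have h2 : ∀ c ∈ J, c.2 = 2 := by
    rintro ⟨i, p⟩ hc
    have hp : p = 0 ∨ p = 1 ∨ p = 2 := by omega
    rcases hp with rfl | rfl | rfl <;> simp_all
  obtain ⟨⟨i, a⟩, ⟨j, b⟩, ⟨k, c⟩, hij, hik, hjk, rfl⟩ := Finset.card_eq_three.1 h3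
  obtain rfl : a = 2 := h2 (i, a) (by simp)
  obtain rfl : b = 2 := h2 (j, b) (by simp)
  obtain rfl : c = 2 := h2 (k, c) (by simp)
  exact Or.inl ⟨i, j, k, by simpa using hij, by simpa using hik, by simpa using hjk, subset_rfl⟩

/-- The third column of each block may be taken to be the top column of another block. -/
theorem CoversTopSec.isOCA {ι α : Type*} [Fintype ι] [Fintype α] {m : ℕ} (hm : 2 ≤ m)
    {top sec : ι → Fin m → α} (h : CoversTopSec top sec) :
    IsOCA 1 (Fintype.card ι) 3 m 3 (Fintype.card α) := by
  have : Nontrivial (Fin m) := Fin.nontrivial_iff_two_le.2 hm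
  choose σ hσ using fun i : Fin m => exists_ne i
  refine IsOCA.of_fintype
    (fun r c => if c.2 = 2 then top r c.1 else if c.2 = 1 then sec r c.1 else top r (σ c.1))
    fun J hJ h3 f => ?_
  rcases hJ.subset_of_card_eq_three h3 with
    ⟨i, j, k, hij, hik, hjk, hs⟩ | ⟨i, j, hij, hs⟩ | ⟨i, hs⟩
  · obtain ⟨r, hr⟩ := h.1 i j k hij hik hjk (f (i, 2)) (f (j, 2)) (f (k, 2))
    refine ⟨r, fun c hc => ?_⟩
    have hc := hs hc
    simp only [Finset.mem_insert, Finset.mem_singleton] at hc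
    rcases hc with rfl | rfl | rfl <;> simp [hr]
  · obtain ⟨r, hr⟩ := h.2 i j hij (f (i, 2)) (f (i, 1)) (f (j, 2))
    refine ⟨r, fun c hc => ?_⟩
    have hc := hs hc
    simp only [Finset.mem_insert, Finset.mem_singleton] at hc
    rcases hc with rfl | rfl | rfl <;> simp [hr]
  · obtain ⟨r, hr⟩ := h.2 i (σ i) (hσ i).symm (f (i, 2)) (f (i, 1)) (f (i, 0))
    refine ⟨r, fun c hc => ?_⟩
    have hc := hs hc
    simp only [Finset.mem_insert, Finset.mem_singleton] at hc
    rcases hc with rfl | rfl | rfl <;> simp [hr]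

section Augmentation

variable {n w N₁ N₂ N₃ : ℕ}

/-- Rows of the array over the alphabet augmented by one symbol. -/
abbrev AugRow (n w N₁ N₂ N₃ : ℕ) : Type :=
  Fin N₁ ⊕ (Fin (n + 1) × Fin N₂) ⊕ Fin N₃ ⊕ (Fin (n + 1) × Fin w × Fin w) ⊕ Unit

/-- The top columns of the augmented array; `none` is the new symbol. -/
def augTop (top : Fin N₁ → Fin (n + 1) → Fin w) (B : Fin N₂ → Fin n → Fin w)
    (C : Fin N₃ → Fin (n + 1) → Fin w) : AugRow n w N₁ N₂ N₃ → Fin (n + 1) → Option (Fin w)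
  | .inl r, i => some (top r i)
  | .inr (.inl (j, r)), i => j.insertNth (α := fun _ => Option (Fin w)) none (some ∘ B r) i
  | .inr (.inr (.inl r)), i => some (C r i)
  | .inr (.inr (.inr (.inl (j, x, _)))), i => if i = j then some x else none
  | .inr (.inr (.inr (.inr _))), _ => none

/-- The second columns of the augmented array; `none` is the new symbol. -/
def augSec (sec : Fin N₁ → Fin (n + 1) → Fin w) :
    AugRow n w N₁ N₂ N₃ → Fin (n + 1) → Option (Fin w)
  | .inl r, i => some (sec r i)
  | .inr (.inr (.inr (.inl (_, _, y)))), _ => some y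
  | _, _ => none

theorem coversTopSec_aug (hn : 2 ≤ n)
    {top sec : Fin N₁ → Fin (n + 1) → Fin w} (hA : CoversTopSec top sec)
    {B : Fin N₂ → Fin n → Fin w}
    (hB : ∀ i j, i ≠ j → ∀ x y, ∃ r, B r i = x ∧ B r j = y)
    {C : Fin N₃ → Fin (n + 1) → Fin w}
    (hC : ∀ i j, i ≠ j → ∀ x y, ∃ r, C r i = x ∧ C r j = y) :
    CoversTopSec (augTop top B C) (augSec sec) := by
  have hB2 : ∀ l i j : Fin (n + 1), i ≠ l → j ≠ l → i ≠ j → ∀ x y,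
      ∃ r : Fin N₂, augTop top B C (.inr (.inl (l, r))) l = none ∧
        augTop top B C (.inr (.inl (l, r))) i = some x ∧
        augTop top B C (.inr (.inl (l, r))) j = some y := by
    intro l i j hi hj hij x y
    obtain ⟨i, rfl⟩ := Fin.exists_succAbove_eq hi
    obtain ⟨j, rfl⟩ := Fin.exists_succAbove_eq hj
    obtain ⟨r, hr⟩ := hB i j (fun h => hij (by rw [h])) x y
    exact ⟨r, by simp [augTop, hr]⟩
  have hthird : ∀ i j : Fin (n + 1), ∃ k, k ≠ i ∧ k ≠ j := by
    intro i j
    obtain ⟨k, hk⟩ := Finset.exists_mem_notMem_of_card_lt_card (s := {i, j}) (t := Finset.univ)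
      (Finset.card_le_two.trans_lt (by simp; omega))
    exact ⟨k, by simpa using hk⟩
  constructor
  · intro i j k hij hik hjk x y z
    have single : ∀ l x, ∃ r, augTop top B C r l = some x ∧
        ∀ l', l' ≠ l → augTop top B C r l' = none := fun l x =>
      ⟨.inr (.inr (.inr (.inl (l, x, x)))), by simp [augTop], fun l' h => by simp [augTop, h]⟩
    rcases x with _ | x <;> rcases y with _ | y <;> rcases z with _ | z
    · exact ⟨.inr (.inr (.inr (.inr ()))), rfl, rfl, rfl⟩
    · obtain ⟨r, h, h'⟩ := single k z
      exact ⟨r, h' _ hik, h' _ hjk, h⟩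
    · obtain ⟨r, h, h'⟩ := single j y
      exact ⟨r, h' _ hij, h, h' _ hjk.symm⟩
    · obtain ⟨r, h⟩ := hB2 i j k hij.symm hik.symm hjk y z
      exact ⟨_, h⟩
    · obtain ⟨r, h, h'⟩ := single i x
      exact ⟨r, h, h' _ hij.symm, h' _ hik.symm⟩
    · obtain ⟨r, h, h', h''⟩ := hB2 j i k hij hjk.symm hik x z
      exact ⟨_, h', h, h''⟩
    · obtain ⟨r, h, h', h''⟩ := hB2 k i j hik hjk hij x y
      exact ⟨_, h', h'', h⟩
    · obtain ⟨r, h⟩ := hA.1 i j k hij hik hjk x y z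
      exact ⟨.inl r, by simp [augTop, h]⟩
  · intro i j hij x y z
    obtain ⟨k, hki, hkj⟩ := hthird i j
    rcases x with _ | x <;> rcases y with _ | y <;> rcases z with _ | z
    · exact ⟨.inr (.inr (.inr (.inr ()))), rfl, rfl, rfl⟩
    · obtain ⟨r, h, h', -⟩ := hB2 i j k hij.symm hki hkj.symm z z
      exact ⟨_, h, rfl, h'⟩
    · exact ⟨.inr (.inr (.inr (.inl (k, y, y)))), by simp [augTop, augSec, hki.symm, hkj.symm]⟩
    · exact ⟨.inr (.inr (.inr (.inl (j, z, y)))), by simp [augTop, augSec, hij]⟩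
    · obtain ⟨r, h, h', -⟩ := hB2 j i k hij hkj hki.symm x x
      exact ⟨_, h', rfl, h⟩
    · obtain ⟨r, h⟩ := hC i j hij x z
      exact ⟨.inr (.inr (.inl r)), by simp [augTop, augSec, h]⟩
    · exact ⟨.inr (.inr (.inr (.inl (i, x, y)))), by simp [augTop, augSec, hij.symm]⟩
    · obtain ⟨r, h⟩ := hA.2 i j hij x y z
      exact ⟨.inl r, by simp [augTop, augSec, h]⟩

end Augmentation

/-- Alphabet augmentation: for `m ≥ 3` and `v ≥ 3`,
`OCAN(3,m,3,v) ≤ OCAN(3,m,2,v-1) + m·CAN(2,m-1,v-1) + CAN(2,m,v-1) + m(v-1)² + 1`. -/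
theorem stmt_6 (m v : ℕ) (hm : 3 ≤ m) (hv : 3 ≤ v) :
    OCAN 1 3 m 3 v ≤
      OCAN 1 3 m 2 (v - 1) + m * CAN 1 2 (m - 1) (v - 1) + CAN 1 2 m (v - 1)
        + m * (v - 1) ^ 2 + 1 := by
  obtain ⟨n, rfl⟩ : ∃ n, m = n + 1 := ⟨m - 1, by omega⟩
  obtain ⟨w, rfl⟩ : ∃ w, v = w + 1 := ⟨v - 1, by omega⟩
  simp only [Nat.add_sub_cancel]
  obtain ⟨top, sec, hA⟩ := (isOCA_OCAN 3 (n + 1) 2 w).exists_coversTopSec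
  obtain ⟨B, hB⟩ := (isCA_CAN 2 n w).exists_pairs
  obtain ⟨C, hC⟩ := (isCA_CAN 2 (n + 1) w).exists_pairs
  have h := (coversTopSec_aug (by omega) hA hB hC).isOCA (by omega)
  rw [Fintype.card_option, Fintype.card_fin] at h
  refine (Nat.sInf_le h).trans (le_of_eq ?_)
  simp only [Fintype.card_sum, Fintype.card_prod, Fintype.card_fin, Fintype.card_unit]
  ring
end

section
/- Let v ≥ 2, s ≥ 1, and 1 ≤ j ≤ 2s be integers, and let V = {0,…,v−1}. There exists an array T with exactly v^j − v^{⌈j/2⌉} rows and 2s columns (viewed as two blocks of s consecutive columns each) over the alphabet V such that: for every pair of nonnegative integers j₁, j₂ with j₁ + j₂ = j, j₁ ≤ s, j₂ ≤ s, setting t̄ = min{j₁,j₂}, and for every tuple (y,z) = (y₁,…,y_{j₁}, z₁,…,z_{j₂}) ∈ V^j satisfying (y_{j₁−t̄+1},…,y_{j₁}) ≠ (z_{j₂−t̄+1},…,z_{j₂}), some row of T has y₁,…,y_{j₁} in its columns s−j₁+1,…,s and z₁,…,z_{j₂} in its columns 2s−j₂+1,…,2s. -/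
/-- At most `v ^ j - v ^ ⌈j / 2⌉` words of length `j` over `Fin v` fail to be palindromes. -/
theorem card_not_palindrome_le (v j : ℕ) :
    Fintype.card {w : Fin j → Fin v // ¬ ∀ i, w i.rev = w i} ≤ v ^ j - v ^ ((j + 1) / 2) := by
  classical
  have hpal : v ^ ((j + 1) / 2) ≤ Fintype.card {w : Fin j → Fin v // ∀ i, w i.rev = w i} := by
    let F : (Fin ((j + 1) / 2) → Fin v) → {w : Fin j → Fin v // ∀ i, w i.rev = w i} := fun f =>
      ⟨fun i => f ⟨min i.val (j - 1 - i.val), by have := i.isLt; omega⟩, fun i => by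
        have := i.isLt
        refine congrArg f (Fin.ext ?_)
        simp only [Fin.val_rev]
        omega⟩
    have hF : Function.Injective F := by
      intro f g h
      funext k
      have hk := k.isLt
      have h' := congrFun (congrArg Subtype.val h) ⟨k.val, by omega⟩
      have hmin : min k.val (j - 1 - k.val) = k.val := by omega
      simpa only [F, hmin, Fin.eta] using h'
    simpa using Fintype.card_le_of_injective F hF
  rw [Fintype.card_subtype_compl]
  simp only [Fintype.card_fun, Fintype.card_fin]
  omega


/-- Existence of the array `T^j`: an array with `v^j - v^{⌈j/2⌉}` rows and `2s`
columns (two blocks of `s` consecutive columns) over the alphabet `Fin v`, such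
that for every split `j = j₁ + j₂` with `j₁, j₂ ≤ s`, every pair of tuples
`y ∈ V^{j₁}`, `z ∈ V^{j₂}` whose length-`min{j₁,j₂}` suffixes differ appears in
some row: `y` right-justified in the first block (columns `s-j₁,…,s-1`,
0-indexed) and `z` right-justified in the second block (columns
`2s-j₂,…,2s-1`, 0-indexed). -/
theorem stmt_9 (v s j : ℕ) (hv : 2 ≤ v) (hs : 1 ≤ s) (hj1 : 1 ≤ j)
    (hj2 : j ≤ 2 * s) :
    ∃ T : Fin (v ^ j - v ^ ((j + 1) / 2)) → Fin (2 * s) → Fin v,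
      ∀ (j₁ j₂ : ℕ) (hsum : j₁ + j₂ = j) (h₁ : j₁ ≤ s) (h₂ : j₂ ≤ s)
        (y : Fin j₁ → Fin v) (z : Fin j₂ → Fin v),
        (∃ i : Fin (min j₁ j₂),
            y ⟨j₁ - min j₁ j₂ + i.val, by have := i.isLt; omega⟩ ≠
            z ⟨j₂ - min j₁ j₂ + i.val, by have := i.isLt; omega⟩) →
        ∃ r : Fin (v ^ j - v ^ ((j + 1) / 2)),
          (∀ i : Fin j₁, T r ⟨s - j₁ + i.val, by have := i.isLt; omega⟩ = y i) ∧
          (∀ i : Fin j₂, T r ⟨s + (s - j₂) + i.val, by have := i.isLt; omega⟩ = z i) := by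
  classical
  have hv0 : 0 < v := by omega
  obtain ⟨e⟩ : Nonempty ({w : Fin j → Fin v // ¬ ∀ i, w i.rev = w i} ↪
      Fin (v ^ j - v ^ ((j + 1) / 2))) :=
    Function.Embedding.nonempty_of_card_le (by simpa using card_not_palindrome_le v j)
  -- Each row holds a word read from the right in the first block and its reversal in the second.
  let W : Fin (v ^ j - v ^ ((j + 1) / 2)) → Fin j → Fin v :=
    Function.extend e Subtype.val fun _ _ => ⟨0, hv0⟩
  let T : Fin (v ^ j - v ^ ((j + 1) / 2)) → Fin (2 * s) → Fin v := fun r c =>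
    if c.val < s then W r ⟨min (s - 1 - c.val) (j - 1), by omega⟩
    else W r ⟨j - 1 - (2 * s - 1 - c.val), by omega⟩
  refine ⟨T, ?_⟩
  rintro j₁ j₂ hsum h₁ h₂ y z ⟨i, hi⟩
  let w : Fin j → Fin v := fun k =>
    if h : k.val < j₁ then y ⟨j₁ - 1 - k.val, by omega⟩
    else z ⟨k.val - j₁, by have := k.isLt; omega⟩
  have hw : ¬ ∀ k, w k.rev = w k := by
    intro hp
    have hit := i.isLt
    have h := hp ⟨min j₁ j₂ - 1 - i.val, by omega⟩
    simp only [w, Fin.val_rev] at h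
    rw [dif_neg (by omega), dif_pos (by omega)] at h
    apply hi
    convert h.symm using 3 <;> omega
  have hW : W (e ⟨w, hw⟩) = w := e.injective.extend_apply _ _ _
  refine ⟨e ⟨w, hw⟩, fun k => ?_, fun k => ?_⟩
  · have hk := k.isLt
    simp only [T, hW, w]
    rw [if_pos (by omega), dif_pos (by omega)]
    congr 1
    ext
    simp only
    omega
  · have hk := k.isLt
    simp only [T, hW, w]
    rw [if_neg (by omega), dif_neg (by omega)]
    congr 1
    ext
    simp only
    omega
end

section
/- Let t, m, s, v be positive integers with v ≥ 2, s ≤ t, m ≥ 2, and t ≤ ms, and set k = min{2s, t}. Then OCAN(t, m+1, s, v) ≤ OCAN(t,m,s,v) + Σ_{j=2}^{k} OCAN(t−j, m−1, s, v)·(v^j − v^{⌈j/2⌉}), where by convention OCAN(0,m−1,s,v) = 1 and OCAN(1,m−1,s,v) = v. -/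
/-- In an up-closed subset of a chain, membership is decided by the distance from the top. -/
theorem mem_iff_rev_lt_card {s : ℕ} (S : Finset (Fin s))
    (hS : ∀ a b : Fin s, a ≤ b → a ∈ S → b ∈ S) (a : Fin s) :
    a ∈ S ↔ (a.rev : ℕ) < S.card := by
  have hrev : (a.rev : ℕ) = s - (a + 1) := Fin.val_rev a
  have ha := a.isLt
  constructor
  · intro h
    have hsub : Finset.Ici a ⊆ S := fun b hb => hS a b (Finset.mem_Ici.1 hb) h
    have hcard := Finset.card_le_card hsub
    rw [Fin.card_Ici] at hcard
    omega
  · intro h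
    by_contra hn
    have hsub : S ⊆ Finset.Ioi a := fun b hb =>
      Finset.mem_Ioi.2 (lt_of_not_ge fun hba => hn (hS b a hba hb))
    have hcard := Finset.card_le_card hsub
    rw [Fin.card_Ioi] at hcard
    omega

theorem IsAntiIdeal.exists_superset_card_eq {m s t : ℕ} (htm : t ≤ m * s)
    {J : Finset (Fin m × Fin s)} (hJ : IsAntiIdeal m s J) (hc : J.card ≤ t) :
    ∃ K, J ⊆ K ∧ IsAntiIdeal m s K ∧ K.card = t := by
  obtain ⟨d, hd⟩ := Nat.exists_eq_add_of_le hc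
  induction d generalizing J with
  | zero => exact ⟨J, subset_rfl, hJ, by omega⟩
  | succ d ih =>
    have hne : Jᶜ.Nonempty := by
      rw [← Finset.card_pos, Finset.card_compl, Fintype.card_prod, Fintype.card_fin,
        Fintype.card_fin]
      omega
    obtain ⟨p, hp, hmax⟩ := Finset.exists_max_image Jᶜ (fun p => p.2) hne
    have hpJ : p ∉ J := Finset.mem_compl.1 hp
    have hcard := Finset.card_insert_of_notMem hpJ
    have hins : IsAntiIdeal m s (insert p J) := by
      intro i a b hab h
      rcases Finset.mem_insert.1 h with h | h
      · subst h
        by_contra hb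
        have hbJ : (i, b) ∉ J := fun h' => hb (Finset.mem_insert_of_mem h')
        have hba : b ≤ a := hmax (i, b) (Finset.mem_compl.2 hbJ)
        exact hb (Finset.mem_insert.2 (Or.inl (by rw [le_antisymm hab hba])))
      · exact Finset.mem_insert_of_mem (hJ i a b hab h)
    obtain ⟨K, hK, hKa, hKc⟩ := ih hins (by omega) (by omega)
    exact ⟨K, (Finset.subset_insert _ _).trans hK, hKa, hKc⟩

/-- The rows of `A` cover every `t`-tuple on every anti-ideal of size `t`. -/
def IsCovering {R : Type*} {m s v : ℕ} (t : ℕ) (A : R → Fin m × Fin s → Fin v) : Prop :=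
  ∀ J : Finset (Fin m × Fin s), IsAntiIdeal m s J → J.card = t →
    ∀ f : Fin m × Fin s → Fin v, ∃ r, ∀ c ∈ J, A r c = f c

theorem IsCovering.isOCA {R : Type*} [Fintype R] {t m s v : ℕ}
    {A : R → Fin m × Fin s → Fin v} (hA : IsCovering t A) :
    IsOCA 1 (Fintype.card R) t m s v := by
  refine ⟨fun r => A ((Fintype.equivFin R).symm r), fun J hJ hc f => ?_⟩
  obtain ⟨r, hr⟩ := hA J hJ hc f
  refine Finset.card_pos.2 ⟨Fintype.equivFin R r, ?_⟩
  simpa using hr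

theorem IsCovering.ocan_le {R : Type*} [Fintype R] {t m s v : ℕ}
    {A : R → Fin m × Fin s → Fin v} (hA : IsCovering t A) :
    OCAN 1 t m s v ≤ Fintype.card R :=
  Nat.sInf_le hA.isOCA

theorem exists_isCovering_ocan (t m s v : ℕ) :
    ∃ A : Fin (OCAN 1 t m s v) → Fin m × Fin s → Fin v, IsCovering t A := by
  have hall : IsCovering t (id : (Fin m × Fin s → Fin v) → Fin m × Fin s → Fin v) :=
    fun _ _ _ f => ⟨f, fun _ _ => rfl⟩
  obtain ⟨A, hA⟩ : IsOCA 1 (OCAN 1 t m s v) t m s v :=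
    Nat.sInf_mem (s := {N | IsOCA 1 N t m s v}) ⟨_, hall.isOCA⟩
  refine ⟨A, fun J hJ hc f => ?_⟩
  obtain ⟨r, hr⟩ := Finset.card_pos.1 (hA J hJ hc f)
  exact ⟨r, (Finset.mem_filter.1 hr).2⟩

/-- Words of length `j` that are not palindromes. -/
abbrev NonPalindrome (j v : ℕ) : Type :=
  {z : Fin j → Fin v // ¬ ∀ d, z d = z d.rev}

theorem card_nonPalindrome_le (j v : ℕ) :
    Fintype.card (NonPalindrome j v) ≤ v ^ j - v ^ ((j + 1) / 2) := by
  have hpal : v ^ ((j + 1) / 2) ≤ Fintype.card {z : Fin j → Fin v // ∀ d, z d = z d.rev} := by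
    let g : (Fin ((j + 1) / 2) → Fin v) → {z : Fin j → Fin v // ∀ d, z d = z d.rev} :=
      fun w => ⟨fun d => w ⟨min d d.rev, by have := Fin.val_rev d; omega⟩, fun d => by
        simp only [Fin.rev_rev, min_comm]⟩
    have hg : Function.Injective g := by
      intro w w' h
      funext e
      have hej : (e : ℕ) < j := by omega
      have he := congrFun (congrArg Subtype.val h) ⟨e, hej⟩
      have hmin : min (e : ℕ) ((Fin.rev (⟨e, hej⟩ : Fin j) : Fin j) : ℕ) = e := by
        rw [Fin.val_rev]
        simp only
        omega
      simpa only [g, hmin] using he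
    simpa using Fintype.card_le_of_injective g hg
  rw [Fintype.card_subtype_compl]
  simp only [Fintype.card_fun, Fintype.card_fin]
  omega

/-- The map of block indices identifying the last two blocks. -/
def foldBlock (n : ℕ) (i : Fin (n + 2)) : Fin (n + 1) :=
  ⟨min i n, by omega⟩

/-- Put an array row on the first `n` blocks and a word `z` on the last two, reading `z`
forwards from the top of the first of these and backwards from the top of the second. -/
noncomputable def wordRow {n s v j : ℕ} [NeZero v] (b : Fin n × Fin s → Fin v)
    (z : Fin j → Fin v) (c : Fin (n + 2) × Fin s) : Fin v :=
  if h : (c.1 : ℕ) < n then b (⟨c.1, h⟩, c.2)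
  else if (c.1 : ℕ) = n then Function.extend Fin.val z 0 c.2.rev
  else Function.extend Fin.val z 0 (j - 1 - c.2.rev)

theorem exists_row_of_agree {R : Type*} {n s t v : ℕ} (htm : t ≤ (n + 1) * s)
    {A : R → Fin (n + 1) × Fin s → Fin v} (hA : IsCovering t A)
    {J : Finset (Fin (n + 2) × Fin s)} (hJ : IsAntiIdeal (n + 2) s J) (hc : J.card = t)
    (f : Fin (n + 2) × Fin s → Fin v)
    (hf : ∀ p ∈ J, ∀ q ∈ J, foldBlock n p.1 = foldBlock n q.1 → p.2 = q.2 → f p = f q) :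
    ∃ r, ∀ c ∈ J, A r (foldBlock n c.1, c.2) = f c := by
  classical
  let φ : Fin (n + 2) × Fin s → Fin (n + 1) × Fin s := fun c => (foldBlock n c.1, c.2)
  have himg : IsAntiIdeal (n + 1) s (J.image φ) := by
    intro i a b hab h
    obtain ⟨⟨k, a'⟩, hp, hpi⟩ := Finset.mem_image.1 h
    obtain ⟨rfl, rfl⟩ := Prod.mk.inj hpi
    exact Finset.mem_image.2 ⟨(k, b), hJ k _ b hab hp, rfl⟩
  obtain ⟨K, hJK, hK, hKc⟩ :=
    himg.exists_superset_card_eq htm (Finset.card_image_le.trans hc.le)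
  obtain ⟨r, hr⟩ := hA K hK hKc fun q =>
    if h : ∃ p ∈ J, φ p = q then f h.choose
    else f (q.1.castSucc, q.2)
  refine ⟨r, fun c hcJ => ?_⟩
  have hex : ∃ p ∈ J, φ p = φ c := ⟨c, hcJ, rfl⟩
  refine (hr (φ c) (hJK (Finset.mem_image_of_mem φ hcJ))).trans ?_
  rw [dif_pos hex]
  obtain ⟨h1, h2⟩ := Prod.mk.inj hex.choose_spec.2
  exact hf _ hex.choose_spec.1 _ hcJ h1 h2

theorem card_eq_sum_fiber {m s : ℕ} (J : Finset (Fin m × Fin s)) :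
    J.card = ∑ i, (Finset.univ.filter fun a => (i, a) ∈ J).card := by
  simp_rw [Finset.card_filter]
  rw [← Fintype.sum_prod_type' (fun i a => if (i, a) ∈ J then 1 else 0)]
  simp

theorem exists_row_of_disagree {R : ℕ → Type*} {n s t v : ℕ} [NeZero v]
    {B : ∀ j, R j → Fin n × Fin s → Fin v} (hB : ∀ j, IsCovering (t - j) (B j))
    {J : Finset (Fin (n + 2) × Fin s)} (hJ : IsAntiIdeal (n + 2) s J) (hc : J.card = t)
    (f : Fin (n + 2) × Fin s → Fin v) {e : Fin s}
    (hx : ((Fin.last n).castSucc, e) ∈ J) (hy : (Fin.last (n + 1), e) ∈ J)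
    (hf : f ((Fin.last n).castSucc, e) ≠ f (Fin.last (n + 1), e)) :
    ∃ j ∈ Finset.Icc 2 (min (2 * s) t), ∃ (z : NonPalindrome j v) (r : R j),
      ∀ c ∈ J, wordRow (B j r) z.1 c = f c := by
  set x : Fin (n + 2) := (Fin.last n).castSucc with hxdef
  set y : Fin (n + 2) := Fin.last (n + 1) with hydef
  let fib : Fin (n + 2) → Finset (Fin s) := fun i => Finset.univ.filter fun a => (i, a) ∈ J
  have hfib : ∀ i a, (i, a) ∈ J ↔ (a.rev : ℕ) < (fib i).card := by
    intro i a
    rw [← mem_iff_rev_lt_card (fib i)]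
    · simp [fib]
    · intro a b hab h
      simp only [fib, Finset.mem_filter, Finset.mem_univ, true_and] at h ⊢
      exact hJ i a b hab h
  have hle : ∀ i, (fib i).card ≤ s := fun i => by
    simpa using Finset.card_le_univ (fib i)
  let J₀ : Finset (Fin n × Fin s) :=
    Finset.univ.filter fun p => (p.1.castSucc.castSucc, p.2) ∈ J
  have hJ₀ : IsAntiIdeal n s J₀ := by
    intro i a b hab h
    simp only [J₀, Finset.mem_filter, Finset.mem_univ, true_and] at h ⊢
    exact hJ _ a b hab h
  have hcard : J.card = J₀.card + (fib x).card + (fib y).card := by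
    rw [card_eq_sum_fiber J, Fin.sum_univ_castSucc, Fin.sum_univ_castSucc,
      card_eq_sum_fiber J₀]
    simp [J₀, fib, x, y]
  obtain ⟨a, ha⟩ : ∃ a, (fib x).card = a := ⟨_, rfl⟩
  obtain ⟨b, hb⟩ : ∃ b, (fib y).card = b := ⟨_, rfl⟩
  have hax := hle x
  have hby := hle y
  have hea := (hfib x e).1 hx
  have heb := (hfib y e).1 hy
  rw [ha] at hcard hax hea
  rw [hb] at hcard hby heb
  have hs : 0 < s := e.pos
  let z : Fin (a + b) → Fin v := fun d =>
    if (d : ℕ) < a then f (x, ⟨s - 1 - d, by omega⟩)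
    else f (y, ⟨s - 1 - (a + b - 1 - d), by omega⟩)
  have hzx : ∀ c : Fin s, ∀ h : (c.rev : ℕ) < a, z ⟨c.rev, by omega⟩ = f (x, c) := by
    intro c h
    simp only [z, h, if_true]
    congr 3
    have := Fin.val_rev c
    omega
  have hzy : ∀ c : Fin s, ∀ h : (c.rev : ℕ) < b,
      z ⟨a + b - 1 - c.rev, by omega⟩ = f (y, c) := by
    intro c h
    have hna : ¬ (a + b - 1 - (c.rev : ℕ)) < a := by omega
    simp only [z, hna, if_false]
    congr 3
    have := Fin.val_rev c
    omega
  have hz : ¬ ∀ d, z d = z d.rev := by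
    intro h
    have hd := h ⟨e.rev, by omega⟩
    rw [hzx e hea] at hd
    refine hf (hd.trans ((congrArg z (Fin.ext ?_)).trans (hzy e heb)))
    rw [Fin.val_rev]
    simp only
    omega
  obtain ⟨r, hr⟩ := hB (a + b) J₀ hJ₀ (by omega) fun p => f (p.1.castSucc.castSucc, p.2)
  refine ⟨a + b, Finset.mem_Icc.2 ⟨by omega, le_min (by omega) (by omega)⟩, ⟨z, hz⟩, r, ?_⟩
  rintro ⟨i, c⟩ hcJ
  unfold wordRow
  split_ifs with h1 h2
  · exact hr (⟨i, h1⟩, c) (Finset.mem_filter.2 ⟨Finset.mem_univ _, hcJ⟩)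
  · obtain rfl : i = x := Fin.ext h2
    have hca := (hfib _ c).1 hcJ
    rw [ha] at hca
    rw [← hzx c hca]
    exact Fin.val_injective.extend_apply z 0 ⟨c.rev, by omega⟩
  · obtain rfl : i = y := Fin.ext (by simp only [y, Fin.val_last] at *; omega)
    have hcb := (hfib _ c).1 hcJ
    rw [hb] at hcb
    rw [← hzy c hcb]
    exact Fin.val_injective.extend_apply z 0 ⟨a + b - 1 - c.rev, by omega⟩

theorem eq_or_last_of_foldBlock_eq {n : ℕ} {i k : Fin (n + 2)}
    (h : foldBlock n i = foldBlock n k) :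
    i = k ∨ (i = (Fin.last n).castSucc ∧ k = Fin.last (n + 1)) ∨
      (k = (Fin.last n).castSucc ∧ i = Fin.last (n + 1)) := by
  simp only [foldBlock, Fin.ext_iff, Fin.val_castSucc, Fin.val_last] at *
  omega

/-- Column-block augmentation: with `k = min(2s, t)`,
`OCAN(t, m+1, s, v) ≤ OCAN(t,m,s,v) + Σ_{j=2}^{k} OCAN(t-j, m-1, s, v)·(v^j - v^{⌈j/2⌉})`.
(With this definition of `OCAN`, the conventions `OCAN(0,m-1,s,v) = 1` and
`OCAN(1,m-1,s,v) = v` hold.) -/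
theorem stmt_10 (t m s v : ℕ) (ht : 1 ≤ t) (hs : 1 ≤ s) (hv : 2 ≤ v)
    (hm : 2 ≤ m) (hst : s ≤ t) (htm : t ≤ m * s) :
    OCAN 1 t (m + 1) s v ≤
      OCAN 1 t m s v +
        ∑ j ∈ Finset.Icc 2 (min (2 * s) t),
          OCAN 1 (t - j) (m - 1) s v * (v ^ j - v ^ ((j + 1) / 2)) := by
  have : NeZero v := ⟨by omega⟩
  obtain ⟨n, rfl⟩ : ∃ n, m = n + 1 := ⟨m - 1, by omega⟩
  rw [Nat.add_sub_cancel]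
  obtain ⟨A, hA⟩ := exists_isCovering_ocan t (n + 1) s v
  choose B hB using fun j => exists_isCovering_ocan (t - j) n s v
  let I := Finset.Icc 2 (min (2 * s) t)
  let C : Fin (OCAN 1 t (n + 1) s v) ⊕
      (Σ j : I, Fin (OCAN 1 (t - j) n s v) × NonPalindrome j v) →
      Fin (n + 2) × Fin s → Fin v :=
    Sum.elim (fun r c => A r (foldBlock n c.1, c.2)) (fun q => wordRow (B q.1 q.2.1) q.2.2.1)
  have hC : IsCovering t C := by
    intro J hJ hc f
    by_cases hf : ∃ e, ((Fin.last n).castSucc, e) ∈ J ∧ (Fin.last (n + 1), e) ∈ J ∧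
        f ((Fin.last n).castSucc, e) ≠ f (Fin.last (n + 1), e)
    · obtain ⟨e, hx, hy, hne⟩ := hf
      obtain ⟨j, hj, z, r, hr⟩ := exists_row_of_disagree hB hJ hc f hx hy hne
      exact ⟨Sum.inr ⟨⟨j, hj⟩, r, z⟩, hr⟩
    · push Not at hf
      obtain ⟨r, hr⟩ := exists_row_of_agree htm hA hJ hc f (by
        rintro ⟨i, a⟩ hp ⟨k, b⟩ hq hik hab
        obtain rfl : a = b := hab
        rcases eq_or_last_of_foldBlock_eq hik with rfl | ⟨rfl, rfl⟩ | ⟨rfl, rfl⟩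
        · rfl
        · exact hf a hp hq
        · exact (hf a hq hp).symm)
      exact ⟨Sum.inl r, hr⟩
  refine hC.ocan_le.trans ?_
  rw [Fintype.card_sum, Fintype.card_sigma, Fintype.card_fin]
  simp only [Fintype.card_prod, Fintype.card_fin]
  rw [Finset.sum_coe_sort I
    (fun j => OCAN 1 (t - j) n s v * Fintype.card (NonPalindrome j v))]
  gcongr with j
  exact card_nonPalindrome_le j v
end

section
/- Let v be a prime power and let t ≥ 4 be an even integer. Then OCAN(t, v+2, t, v) ≤ v^t·(t − (2/(1−v))·(v^{−(t−2)/2} − 1) − v^{−t/2}); equivalently, OCAN(t, v+2, t, v) ≤ t·v^t − (2/(v−1))·(v^t − v^{(t+2)/2}) − v^{t/2}. -/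
open Polynomial in
/-- Hermite interpolation: prescribing the first `n α` Taylor coefficients at every `α` is possible
with a polynomial of degree less than `∑ α, n α`. -/
theorem exists_degree_lt_taylor_coeff {F : Type*} [Field F] [Fintype F] (n : F → ℕ)
    (w : F → ℕ → F) :
    ∃ g : F[X], g.degree < ((∑ α, n α : ℕ) : WithBot ℕ) ∧
      ∀ α, ∀ j < n α, (taylor α g).coeff j = w α j := by
  classical
  obtain ⟨r, hr⟩ := Ideal.exists_forall_sub_mem_ideal
    (I := fun α : F => Ideal.span {(X - C α) ^ n α})
    (fun α β hαβ => by
      change IsCoprime (Ideal.span _) (Ideal.span _)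
      rw [Ideal.isCoprime_span_singleton_iff]
      exact (isCoprime_X_sub_C_of_isUnit_sub (sub_ne_zero.2 hαβ).isUnit).pow)
    (fun α => ∑ j ∈ Finset.range (n α), C (w α j) * (X - C α) ^ j)
  have hmon : (∏ α : F, (X - C α) ^ n α).Monic :=
    monic_prod_of_monic _ _ fun α _ => (monic_X_sub_C α).pow _
  have hdeg : (∏ α : F, (X - C α) ^ n α).degree = ((∑ α, n α : ℕ) : WithBot ℕ) := by
    rw [degree_prod]
    simp
  refine ⟨r %ₘ ∏ α : F, (X - C α) ^ n α, hdeg ▸ degree_modByMonic_lt _ hmon, fun α j hj => ?_⟩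
  have hdvd : (X - C α) ^ n α ∣ (r %ₘ ∏ α : F, (X - C α) ^ n α) -
      ∑ j ∈ Finset.range (n α), C (w α j) * (X - C α) ^ j := by
    have h₁ := Ideal.mem_span_singleton.1 (hr α)
    have h₂ : (X - C α) ^ n α ∣ ∏ α : F, (X - C α) ^ n α :=
      Finset.dvd_prod_of_mem (fun α : F => (X - C α) ^ n α) (Finset.mem_univ α)
    have h₃ := modByMonic_add_div r (∏ α : F, (X - C α) ^ n α)
    have h₄ : (r %ₘ ∏ α : F, (X - C α) ^ n α) = r -
      (∏ α : F, (X - C α) ^ n α) * (r /ₘ ∏ α : F, (X - C α) ^ n α) := by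
      rw [eq_sub_iff_add_eq, h₃]
    rw [h₄, sub_right_comm]
    exact dvd_sub h₁ (h₂.mul_right _)
  obtain ⟨q, hq⟩ := hdvd
  have hq' := congrArg (fun p => (taylor α p).coeff j) (sub_eq_iff_eq_add.1 hq)
  simp only [map_add, taylor_mul, taylor_pow, map_sub, taylor_X, taylor_C, map_sum,
    add_sub_cancel_right, coeff_add, finsetSum_coeff, coeff_C_mul, coeff_X_pow] at hq'
  rw [hq', mul_comm (X ^ n α), coeff_mul_X_pow', if_neg (by omega)]
  simp [hj]

open Polynomial in
/-- Interpolation with prescribed leading coefficients. -/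
theorem exists_ofFn_coeff_taylor_coeff {F : Type*} [Field F] [Fintype F] [DecidableEq F]
    {t m : ℕ} (n : F → ℕ) (hn : ∑ α, n α + m = t) (top : ℕ → F) (w : F → ℕ → F) :
    ∃ c : Fin t → F, (∀ p < m, (ofFn t c).coeff (t - 1 - p) = top p) ∧
      ∀ α, ∀ j < n α, (taylor α (ofFn t c)).coeff j = w α j := by
  set Q : F[X] := ofFn t fun i => top (t - 1 - i) with hQ
  obtain ⟨g, hg, hgw⟩ :=
    exists_degree_lt_taylor_coeff n fun α j => w α j - (taylor α Q).coeff j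
  have hcoeff : ∀ i, t ≤ i → (Q + g).coeff i = 0 := fun i hi => by
    rw [coeff_add, ofFn_coeff_eq_zero_of_ge _ hi,
      coeff_eq_zero_of_degree_lt (hg.trans_le (by exact_mod_cast (by omega))), add_zero]
  have hP : ofFn t (fun i : Fin t => (Q + g).coeff i) = Q + g := by
    ext i
    rcases lt_or_ge i t with hi | hi
    · rw [ofFn_coeff_eq_val_of_lt _ hi]
    · rw [ofFn_coeff_eq_zero_of_ge _ hi, hcoeff i hi]
  refine ⟨fun i => (Q + g).coeff i, fun p hp => ?_, fun α j hj => ?_⟩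
  · rw [hP, coeff_add, hQ, ofFn_coeff_eq_val_of_lt _ (by omega),
      coeff_eq_zero_of_degree_lt (hg.trans_le (by exact_mod_cast (by omega))), add_zero]
    congr 1
    simp only
    omega
  · rw [hP, map_add, coeff_add, hgw α j hj, add_sub_cancel]

/-- An ordered covering array may be given by entries `B r i j`, where `j` is the depth below the
top of block `i`, and with arbitrary types indexing rows, blocks and symbols. -/
theorem isOCA_of_depth {R I F : Type*} [Fintype R] [Fintype I] [Fintype F] {t : ℕ}
    (ht : 0 < t) (B : R → I → ℕ → F)
    (hB : ∀ (n : I → ℕ) (w : I → ℕ → F), ∑ i, n i = t → ∃ r, ∀ i, ∀ j < n i, B r i j = w i j) :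
    IsOCA 1 (Fintype.card R) t (Fintype.card I) t (Fintype.card F) := by
  classical
  let eR := Fintype.equivFin R
  let eI := Fintype.equivFin I
  let eF := Fintype.equivFin F
  refine ⟨fun r c => eF (B (eR.symm r) (eI.symm c.1) (t - 1 - c.2)), fun J hJ hcard f => ?_⟩
  have hsum : ∑ i, (Finset.univ.filter fun a : Fin t => (eI i, a) ∈ J).card = t := by
    rw [Equiv.sum_comp eI fun i => (Finset.univ.filter fun a : Fin t => (i, a) ∈ J).card,
      ← Finset.card_sigma]
    refine Eq.trans ?_ hcard
    exact Finset.card_bij (fun x _ => (x.1, x.2)) (by simp)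
      (fun ⟨a, b⟩ _ ⟨c, d⟩ _ h => by simpa using h) (fun ⟨a, b⟩ h => ⟨⟨a, b⟩, by simpa using h, rfl⟩)
  obtain ⟨r, hr⟩ := hB _ (fun i j => eF.symm (f (eI i, ⟨t - 1 - j, by omega⟩))) hsum
  refine Finset.one_le_card.2 ⟨eR r, Finset.mem_filter.2 ⟨Finset.mem_univ _, fun ⟨i, a⟩ hia => ?_⟩⟩
  have hlt : t - 1 - a < (Finset.univ.filter fun b : Fin t => (eI (eI.symm i), b) ∈ J).card := by
    have hsub : Finset.Ici a ⊆ Finset.univ.filter fun b : Fin t => (eI (eI.symm i), b) ∈ J :=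
      fun b hb => by simpa using hJ i a b (Finset.mem_Ici.1 hb) hia
    have := Finset.card_le_card hsub
    rw [Fin.card_Ici] at this
    omega
  simp only [Equiv.symm_apply_apply, hr _ _ hlt, Equiv.apply_symm_apply]
  congr
  omega

open Polynomial in
/-- The array consists of `k` blocks of rows indexed by polynomials of degree less than `2 * k`.
In block `h` the columns over `F` are Taylor coefficients, and the two additional columns list
leading coefficients so as to cover all anti-ideals meeting those columns in `a` and `b` elements
with `min a b = h`. The remaining rows cover the anti-ideals with `a = b = k`. -/
noncomputable def hookArray (F : Type*) [Field F] [DecidableEq F] (k : ℕ) :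
    (Fin k × (Fin (2 * k) → F)) ⊕ {p : (Fin k → F) × (Fin k → F) // p.1 ≠ p.2} →
      Option (Option F) → ℕ → F
  | .inl (_, c), some (some α), j => (taylor α (ofFn (2 * k) c)).coeff j
  | .inl (h, c), none, j => (ofFn (2 * k) c).coeff (2 * k - 1 - if j < h then j else j + h)
  | .inl (h, c), some none, j => (ofFn (2 * k) c).coeff (2 * k - 1 - (j + h))
  | .inr _, some (some _), _ => 0
  | .inr p, none, j => if hj : j < k then p.1.1 ⟨j, hj⟩ else 0
  | .inr p, some none, j => if hj : j < k then p.1.2 ⟨j, hj⟩ else 0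

theorem hookArray_covers (F : Type*) [Field F] [Fintype F] [DecidableEq F] {k : ℕ} (hk : 0 < k)
    (n : Option (Option F) → ℕ) (w : Option (Option F) → ℕ → F) (hn : ∑ i, n i = 2 * k) :
    ∃ r, ∀ i, ∀ j < n i, hookArray F k r i j = w i j := by
  rw [Fintype.sum_option, Fintype.sum_option] at hn
  have key : ∀ (h : Fin k) (top : ℕ → F),
      (∀ j < n none, (if j < h then j else j + h) < n none + n (some none) ∧
        top (if j < h then j else j + h) = w none j) →
      (∀ j < n (some none), j + h < n none + n (some none) ∧ top (j + h) = w (some none) j) →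
      ∃ r, ∀ i, ∀ j < n i, hookArray F k r i j = w i j := by
    intro h top h₁ h₂
    obtain ⟨c, hc, hc'⟩ := exists_ofFn_coeff_taylor_coeff (t := 2 * k)
      (m := n none + n (some none)) (fun α => n (some (some α))) (by omega) top
      (fun α => w (some (some α)))
    refine ⟨.inl (h, c), ?_⟩
    rintro (_ | _ | α) j hj
    · rw [hookArray, hc _ (h₁ j hj).1, (h₁ j hj).2]
    · rw [hookArray, hc _ (h₂ j hj).1, (h₂ j hj).2]
    · exact hc' α j hj
  by_cases ha : n none < k ∧ n none ≤ n (some none)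
  · refine key ⟨n none, ha.1⟩
      (fun p => if p < n none then w none p else w (some none) (p - n none)) ?_ ?_
    · intro j hj
      simp [hj]
      omega
    · intro j hj
      simp
      omega
  by_cases hb : n (some none) < k ∧ n (some none) ≤ n none
  · refine key ⟨n (some none), hb.1⟩
      (fun p => if p < n (some none) then w none p else if p < 2 * n (some none) then
        w (some none) (p - n (some none)) else w none (p - n (some none))) ?_ ?_
    · intro j hj
      dsimp only
      split_ifs <;> first | omega | exact ⟨by omega, rfl⟩ | simp; omega
    · intro j hj
      dsimp only
      rw [if_neg (by omega), if_pos (by omega)]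
      exact ⟨by omega, by simp⟩
  have hna : n none = k := by omega
  have hnb : n (some none) = k := by omega
  have hz : ∀ α, n (some (some α)) = 0 := fun α => by
    have := Finset.single_le_sum (f := fun α => n (some (some α))) (fun _ _ => Nat.zero_le _)
      (Finset.mem_univ α)
    omega
  by_cases heq : ∀ j < k, w none j = w (some none) j
  · refine ⟨.inl (⟨0, hk⟩, fun i => w none (2 * k - 1 - i)), ?_⟩
    rintro (_ | _ | α) j hj
    · rw [hookArray, if_neg (by simp), Polynomial.ofFn_coeff_eq_val_of_lt _ (by omega)]
      congr 1
      simp only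
      omega
    · rw [← heq j (by omega), hookArray, Polynomial.ofFn_coeff_eq_val_of_lt _ (by omega)]
      congr 1
      simp only
      omega
    · exact absurd hj (by simp [hz])
  · refine ⟨.inr ⟨(fun j => w none j, fun j => w (some none) j), fun h => heq fun j hj =>
      congrFun h ⟨j, hj⟩⟩, ?_⟩
    rintro (_ | _ | α) j hj
    · simp [hookArray, hna ▸ hj]
    · simp [hookArray, hnb ▸ hj]
    · exact absurd hj (by simp [hz])

theorem card_ne_pairs (α : Type*) [Fintype α] [DecidableEq α] :
    Fintype.card {p : α × α // p.1 ≠ p.2} + Fintype.card α =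
      Fintype.card α * Fintype.card α := by
  have h := Fintype.card_subtype_compl fun p : α × α => p.1 = p.2
  have h' : Fintype.card {p : α × α // p.1 = p.2} = Fintype.card α :=
    Fintype.card_congr ⟨fun p => p.1.1, fun a => ⟨(a, a), rfl⟩,
      fun ⟨⟨a, b⟩, hab⟩ => by simpa using hab, fun _ => rfl⟩
  rw [h', Fintype.card_prod] at h
  have := Nat.le_mul_self (Fintype.card α)
  change Fintype.card {p : α × α // ¬ p.1 = p.2} + _ = _
  omega

/-- For a prime power `v`, `OCAN(2k, v + 2, 2k, v) ≤ (k + 1) v ^ (2k) - v ^ k`. -/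
theorem ocan_add_pow_le {v k : ℕ} (hv : IsPrimePow v) (hk : 0 < k) :
    OCAN 1 (2 * k) (v + 2) (2 * k) v + v ^ k ≤ (k + 1) * v ^ (2 * k) := by
  classical
  obtain ⟨p, n, hp, hn, rfl⟩ := hv
  have : Fact p.Prime := ⟨hp.nat_prime⟩
  let F := GaloisField p n
  let : Fintype F := Fintype.ofFinite F
  have hF : Fintype.card F = p ^ n := by
    rw [← Nat.card_eq_fintype_card, GaloisField.card p n hn.ne']
  have h := isOCA_of_depth (by omega : 0 < 2 * k) (hookArray F k) (hookArray_covers F hk)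
  have hcard := card_ne_pairs (Fin k → F)
  rw [Fintype.card_fun, Fintype.card_fin, hF] at hcard
  rw [Fintype.card_sum, Fintype.card_prod, Fintype.card_option, Fintype.card_option,
    Fintype.card_fun, Fintype.card_fin, Fintype.card_fin, hF] at h
  have hle : OCAN 1 (2 * k) (p ^ n + 2) (2 * k) (p ^ n) ≤ _ := Nat.sInf_le h
  rw [← pow_add, ← two_mul] at hcard
  rw [add_mul, one_mul]
  omega

theorem two_mul_pow_sub_one_le {x : ℝ} (hx : 2 ≤ x) (m : ℕ) :
    2 * (x ^ m - 1) ≤ m * x ^ m * (x - 1) := by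
  induction m with
  | zero => simp
  | succ m ih =>
    have h₁ : (1 : ℝ) ≤ x ^ m := one_le_pow₀ (by linarith)
    have h₂ : 2 ≤ x ^ (m + 1) := by rw [pow_succ]; nlinarith
    have h₃ := mul_le_mul_of_nonneg_left ih (by linarith : 0 ≤ x)
    have h₄ := mul_le_mul_of_nonneg_right h₂ (by linarith : 0 ≤ x - 1)
    push_cast
    rw [pow_succ] at *
    nlinarith

/-- For `v` a prime power and `t ≥ 4` even:
`OCAN(t, v+2, t, v) ≤ t·v^t - (2/(v-1))·(v^t - v^{(t+2)/2}) - v^{t/2}`. -/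
theorem stmt_12 (v t : ℕ) (hv : IsPrimePow v) (ht : 4 ≤ t) (heven : Even t) :
    (OCAN 1 t (v + 2) t v : ℝ) ≤
      t * (v : ℝ) ^ t - (2 / ((v : ℝ) - 1)) * ((v : ℝ) ^ t - (v : ℝ) ^ ((t + 2) / 2))
        - (v : ℝ) ^ (t / 2) := by
  obtain ⟨k, rfl⟩ := heven
  obtain ⟨m, rfl⟩ : ∃ m, k = m + 1 := ⟨k - 1, by omega⟩
  have hx : (2 : ℝ) ≤ v := by exact_mod_cast hv.two_le
  have h : (OCAN 1 (2 * (m + 1)) (v + 2) (2 * (m + 1)) v : ℝ) + (v : ℝ) ^ (m + 1) ≤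
      (m + 1 + 1) * (v : ℝ) ^ (2 * (m + 1)) := by
    exact_mod_cast ocan_add_pow_le hv m.succ_pos
  have hle : 2 / ((v : ℝ) - 1) * ((v : ℝ) ^ (2 * (m + 1)) - (v : ℝ) ^ (m + 2)) ≤
      m * (v : ℝ) ^ (2 * (m + 1)) := by
    rw [div_mul_eq_mul_div, div_le_iff₀ (by linarith)]
    have := mul_le_mul_of_nonneg_left (two_mul_pow_sub_one_le hx m)
      (by positivity : 0 ≤ (v : ℝ) ^ (m + 2))
    ring_nf at this ⊢
    linarith
  rw [← two_mul, show (2 * (m + 1) + 2) / 2 = m + 2 by omega,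
    show 2 * (m + 1) / 2 = m + 1 by omega]
  push_cast
  linarith
end

section
/- Let q, s, k be integers with q ≥ 2, s ≥ 3, and k ≥ 1. For every j with 1 ≤ j ≤ s, K_q(2k+1, s, (k+1)s − j) ≤ q^{ks+j} − q^{k(s−2)+j}·(q^k − 1). -/
/-- The NRT distance on `Z_q^{ms}` (coordinates indexed by `Fin m × Fin s`,
block `i`, position `a` within block): the cardinality of the ideal of the NRT
poset `[m·s]` generated by the support of `x - y`; a coordinate `(i, a)` lies in
this ideal iff `x` and `y` differ at some `(i, b)` with `a ≤ b`. -/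
def nrtDist (m s q : ℕ) (x y : Fin m × Fin s → Fin q) : ℕ :=
  (Finset.univ.filter (fun c : Fin m × Fin s =>
    ∃ b : Fin s, c.2 ≤ b ∧ x (c.1, b) ≠ y (c.1, b))).card

/-- `nrtK q m s R` is the smallest cardinality of an `R`-covering code of the
NRT space `Z_q^{ms}`. -/
noncomputable def nrtK (q m s R : ℕ) : ℕ :=
  sInf {n | ∃ C : Finset (Fin m × Fin s → Fin q), C.card = n ∧
    ∀ x : Fin m × Fin s → Fin q, ∃ c ∈ C, nrtDist m s q x c ≤ R}

/-- Words agreeing on an up-closed set of coordinates are close in the NRT distance. -/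
theorem nrtDist_add_card_le {m s q : ℕ} {x y : Fin m × Fin s → Fin q}
    (A : Finset (Fin m × Fin s))
    (hA : ∀ p ∈ A, ∀ b, p.2 ≤ b → (p.1, b) ∈ A) (hxy : ∀ p ∈ A, x p = y p) :
    nrtDist m s q x y + A.card ≤ m * s := by
  unfold nrtDist
  rw [← Finset.card_union_of_disjoint]
  · exact (Finset.card_le_univ _).trans (by simp)
  · rw [Finset.disjoint_left]
    intro p hp hpA
    obtain ⟨b, hb, hne⟩ := (Finset.mem_filter.mp hp).2
    exact hne (hxy _ (hA p hpA b hb))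

/-- At least `q ^ (|ι| - 1)` of the words indexed by `ι` have equal entries at two given places. -/
theorem pow_le_card_filter_eq {ι : Type*} [Fintype ι] [DecidableEq ι] (q : ℕ) {a b : ι}
    (hab : a ≠ b) :
    q ^ (Fintype.card ι - 1) ≤
      (Finset.univ.filter (fun f : ι → Fin q => f a = f b)).card := by
  have hcard : (Finset.univ : Finset ({i : ι // i ≠ b} → Fin q)).card
      = q ^ (Fintype.card ι - 1) := by
    simp [Fintype.card_subtype_compl]
  rw [← hcard]
  refine Finset.card_le_card_of_injOn
    (fun g i => if h : i = b then g ⟨a, hab⟩ else g ⟨i, h⟩) ?_ ?_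
  · intro g _
    simp [hab]
  · intro g _ g' _ h
    funext i
    have hi := congrFun h i.1
    simpa [i.2] using hi

theorem card_filter_ne_le {ι : Type*} [Fintype ι] [DecidableEq ι] (q : ℕ) {a b : ι}
    (hab : a ≠ b) :
    (Finset.univ.filter (fun f : ι → Fin q => f a ≠ f b)).card ≤
      q ^ Fintype.card ι - q ^ (Fintype.card ι - 1) := by
  have h1 := pow_le_card_filter_eq q hab
  have h2 := Finset.card_filter_add_card_filter_not (s := Finset.univ)
    (fun f : ι → Fin q => f a = f b)
  rw [Finset.card_univ, Fintype.card_fun, Fintype.card_fin] at h2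
  simp only [ne_eq]
  omega

/-- Let `F` be an up-closed set of coordinates with two minimal elements `p₀ ≠ p₁`, and let `r` be
the top coordinate of a block, `r ∉ F`. The words supported on `F ∪ {r}` (up to a fixed symbol) whose
entry at `r` repeats that at `p₀` and differs from that at `p₁` form a covering. -/
theorem nrtK_le_pow_sub_pow {q m s : ℕ} (hq : 2 ≤ q) (F : Finset (Fin m × Fin s))
    {p₀ p₁ r : Fin m × Fin s} (h₀ : p₀ ∈ F) (h₁ : p₁ ∈ F) (hr : r ∉ F) (hne : p₀ ≠ p₁)
    (hF : ∀ p ∈ F, ∀ b, p.2 ≤ b → (p.1, b) ∈ F)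
    (hmin₀ : ∀ a, (p₀.1, a) ∈ F → p₀.2 ≤ a) (hmin₁ : ∀ a, (p₁.1, a) ∈ F → p₁.2 ≤ a)
    (hmax : ∀ b, r.2 ≤ b → b = r.2) :
    nrtK q m s (m * s - F.card) ≤ q ^ F.card - q ^ (F.card - 1) := by
  classical
  let z : Fin q := ⟨0, by omega⟩
  let e : (F → Fin q) → Fin m × Fin s → Fin q := fun f p =>
    if h : p ∈ F then f ⟨p, h⟩ else if p = r then f ⟨p₀, h₀⟩ else z
  let S : Finset (F → Fin q) := Finset.univ.filter (fun f => f ⟨p₀, h₀⟩ ≠ f ⟨p₁, h₁⟩)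
  have hS : S.card ≤ q ^ F.card - q ^ (F.card - 1) := by
    have := card_filter_ne_le q (a := (⟨p₀, h₀⟩ : F)) (b := ⟨p₁, h₁⟩) (by simpa using hne)
    simpa using this
  refine le_trans (Nat.sInf_le ⟨S.image e, rfl, ?_⟩) (Finset.card_image_le.trans hS)
  intro x
  have key : ∀ (g : Fin m × Fin s → Fin q) (A : Finset (Fin m × Fin s)), g p₀ ≠ g p₁ →
      (∀ p ∈ A, ∀ b, p.2 ≤ b → (p.1, b) ∈ A) → A.card = F.card →
      (∀ p ∈ A, p ∈ F → x p = g p) → (∀ p ∈ A, p ∉ F → p = r ∧ x r = g p₀) →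
      ∃ c ∈ S.image e, nrtDist m s q x c ≤ m * s - F.card := by
    intro g A hg hA hcard hx hxr
    refine ⟨e (fun p => g p), Finset.mem_image_of_mem _ (by simpa [S] using hg), ?_⟩
    have := nrtDist_add_card_le (x := x) (y := e (fun p => g p)) A hA (by
      intro p hp
      by_cases hpF : p ∈ F
      · simpa [e, hpF] using hx p hp hpF
      · obtain ⟨rfl, h⟩ := hxr p hp hpF
        simpa [e, hpF] using h)
    omega
  have swap_card : ∀ p ∈ F, (insert r (F.erase p)).card = F.card := by
    intro p hp
    rw [Finset.card_insert_of_notMem (fun h => hr (Finset.mem_of_mem_erase h)),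
      Finset.card_erase_add_one hp]
  have swap_closed : ∀ p ∈ F, (∀ a, (p.1, a) ∈ F → p.2 ≤ a) →
      ∀ p' ∈ insert r (F.erase p), ∀ b, p'.2 ≤ b → (p'.1, b) ∈ insert r (F.erase p) := by
    intro p hp hmin p' hp' b hb
    rcases Finset.mem_insert.mp hp' with rfl | hp'
    · rw [hmax b hb]
      exact Finset.mem_insert_self _ _
    · obtain ⟨hne', hp'F⟩ := Finset.mem_erase.mp hp'
      refine Finset.mem_insert_of_mem (Finset.mem_erase.mpr ⟨?_, hF p' hp'F b hb⟩)
      rintro rfl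
      exact hne' (Prod.ext rfl (le_antisymm hb (hmin _ hp'F)))
  have swap_new : ∀ p, ∀ p' ∈ insert r (F.erase p), p' ∉ F → p' = r := by
    intro p p' hp' hpF
    rcases Finset.mem_insert.mp hp' with h | h
    · exact h
    · exact absurd (Finset.mem_of_mem_erase h) hpF
  have swap_ne : ∀ p ∈ F, ∀ p' ∈ insert r (F.erase p), p' ≠ p := by
    rintro p hp p' hp' rfl
    rcases Finset.mem_insert.mp hp' with rfl | h
    · exact hr hp
    · simp at h
  by_cases hx01 : x p₀ = x p₁
  · by_cases hxr : x r = x p₀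
    · obtain ⟨w, hw⟩ : ∃ w : Fin q, w ≠ x p₀ := by
        have : Nontrivial (Fin q) := Fin.nontrivial_iff_two_le.mpr hq
        exact exists_ne _
      refine key (Function.update x p₁ w) (insert r (F.erase p₁)) ?_
        (swap_closed p₁ h₁ hmin₁) (swap_card p₁ h₁) ?_ ?_
      · simpa [Function.update_of_ne hne] using hw.symm
      · intro p hp _
        rw [Function.update_of_ne (swap_ne p₁ h₁ p hp)]
      · intro p hp hpF
        exact ⟨swap_new p₁ p hp hpF, by rw [Function.update_of_ne hne, hxr]⟩
    · refine key (Function.update x p₀ (x r)) (insert r (F.erase p₀)) ?_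
        (swap_closed p₀ h₀ hmin₀) (swap_card p₀ h₀) ?_ ?_
      · rw [Function.update_self, Function.update_of_ne hne.symm, ← hx01]
        exact hxr
      · intro p hp _
        rw [Function.update_of_ne (swap_ne p₀ h₀ p hp)]
      · intro p hp hpF
        exact ⟨swap_new p₀ p hp hpF, by rw [Function.update_self]⟩
  · exact key x F hx01 hF rfl (fun _ _ _ => rfl) (fun p hp hpF => absurd hp hpF)

/-- For `q ≥ 2`, `s ≥ 3`, `k ≥ 1` and `1 ≤ j ≤ s`:
`K_q(2k+1, s, (k+1)s - j) ≤ q^{ks+j} - q^{k(s-2)+j}(q^k - 1)`. -/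
theorem stmt_13 (q s k j : ℕ) (hq : 2 ≤ q) (hs : 3 ≤ s) (hk : 1 ≤ k)
    (hj1 : 1 ≤ j) (hj2 : j ≤ s) :
    nrtK q (2 * k + 1) s ((k + 1) * s - j) ≤
      q ^ (k * s + j) - q ^ (k * (s - 2) + j) * (q ^ k - 1) := by
  let kk : Fin (2 * k + 1) := ⟨k, by omega⟩
  let t : Fin s := ⟨s - j, by omega⟩
  let F : Finset (Fin (2 * k + 1) × Fin s) :=
    Finset.Iio kk ×ˢ Finset.univ ∪ {kk} ×ˢ Finset.Ici t
  have memF : ∀ p, p ∈ F ↔ p.1.1 < k ∨ p.1.1 = k ∧ s - j ≤ p.2.1 := by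
    intro p
    simp only [F, kk, t, Finset.mem_union, Finset.mem_product, Finset.mem_Iio, Finset.mem_univ,
      and_true, Finset.mem_singleton, Finset.mem_Ici, Fin.lt_def, Fin.le_def, Fin.ext_iff]
  have hcard : F.card = k * s + j := by
    rw [Finset.card_union_of_disjoint]
    · simp [kk, t]
      omega
    · rw [Finset.disjoint_left]
      intro p hp hp'
      simp only [Finset.mem_product, Finset.mem_Iio, Finset.mem_singleton] at hp hp'
      exact absurd hp'.1 hp.1.ne
  have hmain := nrtK_le_pow_sub_pow hq F (p₀ := (⟨0, by omega⟩, ⟨0, by omega⟩)) (p₁ := (kk, t))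
    (r := (⟨k + 1, by omega⟩, ⟨s - 1, by omega⟩))
    ((memF _).2 (Or.inl hk)) ((memF _).2 (Or.inr ⟨rfl, le_rfl⟩))
    (by rw [memF]; simp) (by simp only [kk, ne_eq, Prod.mk.injEq, Fin.mk.injEq]; omega)
    (by
      intro p hp b hb
      rw [memF] at hp ⊢
      have : p.2.1 ≤ b.1 := hb
      dsimp only
      omega)
    (by intro a _; exact Nat.zero_le _)
    (by
      intro a ha
      rw [memF] at ha
      simp only [kk] at ha
      change s - j ≤ a.1
      omega)
    (by
      intro b hb
      have : s - 1 ≤ b.1 := hb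
      ext
      dsimp only
      omega)
  have hR : (2 * k + 1) * s - (k * s + j) = (k + 1) * s - j := by
    have h1 : (2 * k + 1) * s = 2 * (k * s) + s := by ring
    have h2 : (k + 1) * s = k * s + s := by ring
    omega
  rw [hcard, hR] at hmain
  refine hmain.trans (Nat.sub_le_sub_left ?_ _)
  calc q ^ (k * (s - 2) + j) * (q ^ k - 1) ≤ q ^ (k * (s - 2) + j) * q ^ k :=
        Nat.mul_le_mul_left _ (Nat.sub_le _ _)
    _ = q ^ (k * (s - 2) + j + k) := (pow_add _ _ _).symm
    _ ≤ q ^ (k * s + j - 1) := by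
        refine Nat.pow_le_pow_right (by omega) ?_
        obtain ⟨u, rfl⟩ : ∃ u, s = u + 2 := ⟨s - 2, by omega⟩
        have : k * (u + 2) = k * u + 2 * k := by ring
        rw [Nat.add_sub_cancel]
        omega
end

section
/- Let q, s, k be integers with q ≥ 2, s ≥ 3, and k ≥ 1. Then K_q(2k, s, ks) ≤ q^{ks} − q^{k(s−2)}·(q^k − 1). -/
/-- The size of any covering code bounds `nrtK` from above. -/
theorem nrtK_le_card {q m s R : ℕ} (C : Finset (Fin m × Fin s → Fin q))
    (hC : ∀ x, ∃ c ∈ C, nrtDist m s q x c ≤ R) : nrtK q m s R ≤ C.card :=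
  Nat.sInf_le ⟨C, rfl, hC⟩

/-- A covering family of codewords indexed by a finite type bounds `nrtK` from above. -/
theorem nrtK_le_fintype_card {q m s R : ℕ} {ι : Type*} [Fintype ι]
    (f : ι → Fin m × Fin s → Fin q) (hf : ∀ x, ∃ i, nrtDist m s q x (f i) ≤ R) :
    nrtK q m s R ≤ Fintype.card ι := by
  classical
  refine (nrtK_le_card (Finset.univ.image f) fun x => ?_).trans Finset.card_image_le
  obtain ⟨i, hi⟩ := hf x
  exact ⟨f i, Finset.mem_image_of_mem f (Finset.mem_univ i), hi⟩

/-- If the blocks are split into two halves of `k` blocks, and two words agree from position `α`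
on in the first half and from position `β` on in the second half, then their NRT distance is at
most `k * (α + β)`. -/
theorem nrtDist_le_of_agree {m s q k : ℕ} (e : Fin m ≃ Fin k ⊕ Fin k)
    {x y : Fin m × Fin s → Fin q} (α β : ℕ)
    (hα : ∀ (i : Fin k) (b : Fin s), α ≤ b → x (e.symm (.inl i), b) = y (e.symm (.inl i), b))
    (hβ : ∀ (i : Fin k) (b : Fin s), β ≤ b → x (e.symm (.inr i), b) = y (e.symm (.inr i), b)) :
    nrtDist m s q x y ≤ k * (α + β) := by
  classical
  let T : Finset ((Fin k ⊕ Fin k) × ℕ) :=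
    (Finset.univ.map .inl ×ˢ Finset.range α) ∪ (Finset.univ.map .inr ×ˢ Finset.range β)
  have hT : T.card ≤ k * (α + β) := by
    refine (Finset.card_union_le _ _).trans ?_
    simp [Finset.card_product, mul_add]
  refine le_trans (Finset.card_le_card_of_injOn (t := T) (fun c => (e c.1, (c.2 : ℕ))) ?_ ?_) hT
  · rintro ⟨i, a⟩ h
    obtain ⟨j, rfl⟩ := e.symm.surjective i
    simp only [Finset.coe_filter, Finset.mem_univ, true_and, Set.mem_ofPred_eq] at h
    obtain ⟨b, hab, hb⟩ := h
    have hab' : (a : ℕ) ≤ b := hab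
    rcases j with j | j
    · have : (a : ℕ) < α := by
        by_contra! h
        exact hb (hα j b (h.trans hab'))
      simp [T, this]
    · have : (a : ℕ) < β := by
        by_contra! h
        exact hb (hβ j b (h.trans hab'))
      simp [T, this]
  · rintro ⟨i, a⟩ - ⟨j, b⟩ - h
    simpa [Fin.ext_iff] using h

/-- The word whose first half of blocks is read off `U` and whose second half is read off `W`. -/
def wordOfHalves {m s q k : ℕ} (e : Fin m ≃ Fin k ⊕ Fin k) (U W : ℕ → Fin k → Fin q) :
    Fin m × Fin s → Fin q :=
  fun c => Sum.elim (U c.2) (W c.2) (e c.1)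

/-- The layers of the first half of a codeword: `u` at position `0`, `a` at position `1`, and
`w` above. -/
def lowLayers {V : Type*} {t : ℕ} (w : Fin t → V) (a u : V) (n : ℕ) : V :=
  if n = 0 then u else if n = 1 then a else if h : n - 2 < t then w ⟨n - 2, h⟩ else u

/-- The layers of the second half of a codeword: `v` at position `t`, `b` above, and `z` below. -/
def highLayers {V : Type*} (t : ℕ) (z b v : V) (n : ℕ) : V :=
  if n < t then z else if n = t then v else b

/-- The codewords of the covering: regarding `k` parallel blocks as a single block over the
alphabet `V = Z_q^k`, the last two free layers of each half are `(z, v), (z, v)` or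
`(a, z), (b, z)` with `a, b ≠ z`. -/
def coveringWord {m q k t : ℕ} (e : Fin m ≃ Fin k ⊕ Fin k) (z : Fin k → Fin q) :
    (Fin t → Fin k → Fin q) ×
      ((Fin k → Fin q) ⊕ {a : Fin k → Fin q // a ≠ z} × {b : Fin k → Fin q // b ≠ z}) →
      Fin m × Fin (t + 2) → Fin q
  | (w, .inl v) => wordOfHalves e (lowLayers w z v) (highLayers t z z v)
  | (w, .inr (a, b)) => wordOfHalves e (lowLayers w a z) (highLayers t z b z)

theorem exists_coveringWord_nrtDist_le {m q k t : ℕ} (e : Fin m ≃ Fin k ⊕ Fin k)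
    (z : Fin k → Fin q) (x : Fin m × Fin (t + 2) → Fin q) :
    ∃ p, nrtDist m (t + 2) q x (coveringWord e z p) ≤ k * (t + 2) := by
  let U : Fin (t + 2) → Fin k → Fin q := fun b i => x (e.symm (.inl i), b)
  let W : Fin (t + 2) → Fin k → Fin q := fun b i => x (e.symm (.inr i), b)
  let w : Fin t → Fin k → Fin q := fun j => U ⟨j + 2, by omega⟩
  have low (a u : Fin k → Fin q) (b : Fin (t + 2)) (h0 : (b : ℕ) = 0 → u = U b)
      (h1 : (b : ℕ) = 1 → a = U b) : lowLayers w a u b = U b := by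
    unfold lowLayers
    split_ifs with h h' h''
    · exact h0 h
    · exact h1 h'
    · exact congrArg U (Fin.ext (by simp only; omega))
    · omega
  have high (c v : Fin k → Fin q) (b : Fin (t + 2)) (hb : t ≤ b) (h0 : (b : ℕ) = t → v = W b)
      (h1 : (b : ℕ) = t + 1 → c = W b) : highLayers t z c v b = W b := by
    unfold highLayers
    split_ifs with h h'
    · omega
    · exact h0 h'
    · exact h1 (by omega)
  by_cases ha : U ⟨1, by omega⟩ = z
  · refine ⟨(w, .inl (U ⟨0, by omega⟩)),
      (nrtDist_le_of_agree e 0 (t + 2) (fun i b _ => ?_) fun i b h => ?_).trans_eq (by ring)⟩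
    · have := low z (U ⟨0, by omega⟩) b (fun h => congrArg U (Fin.ext h.symm))
        (fun h => ha.symm.trans (congrArg U (Fin.ext h.symm)))
      simp only [coveringWord, wordOfHalves, Equiv.apply_symm_apply]
      exact (congrFun this i).symm
    · omega
  by_cases hb : W ⟨t + 1, by omega⟩ = z
  · refine ⟨(w, .inl (W ⟨t, by omega⟩)),
      (nrtDist_le_of_agree e 2 t (fun i b h => ?_) fun i b h => ?_).trans_eq (by ring)⟩
    · have := low z (W ⟨t, by omega⟩) b (by omega) (by omega)
      simp only [coveringWord, wordOfHalves, Equiv.apply_symm_apply]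
      exact (congrFun this i).symm
    · have := high z (W ⟨t, by omega⟩) b h (fun h => congrArg W (Fin.ext h.symm))
        (fun h => hb.symm.trans (congrArg W (Fin.ext h.symm)))
      simp only [coveringWord, wordOfHalves, Equiv.apply_symm_apply]
      exact (congrFun this i).symm
  · refine ⟨(w, .inr (⟨_, ha⟩, ⟨_, hb⟩)),
      (nrtDist_le_of_agree e 1 (t + 1) (fun i b h => ?_) fun i b h => ?_).trans_eq (by ring)⟩
    · have := low (U ⟨1, by omega⟩) z b (by omega) (fun h => congrArg U (Fin.ext h.symm))
      simp only [coveringWord, wordOfHalves, Equiv.apply_symm_apply]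
      exact (congrFun this i).symm
    · have := high (W ⟨t + 1, by omega⟩) z b (by omega) (by omega)
        (fun h => congrArg W (Fin.ext h.symm))
      simp only [coveringWord, wordOfHalves, Equiv.apply_symm_apply]
      exact (congrFun this i).symm

/-- `K_q(2k, s, ks) ≤ q^{ks} - q^{k(s-2)}(q^k - 1)`. -/
theorem stmt_15 (q s k : ℕ) (hq : 2 ≤ q) (hs : 3 ≤ s) (hk : 1 ≤ k) :
    nrtK q (2 * k) s (k * s) ≤ q ^ (k * s) - q ^ (k * (s - 2)) * (q ^ k - 1) := by
  obtain ⟨t, rfl⟩ : ∃ t, s = t + 2 := ⟨s - 2, by omega⟩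
  have e : Fin (2 * k) ≃ Fin k ⊕ Fin k := Fintype.equivOfCardEq (by simp [two_mul])
  let z : Fin k → Fin q := fun _ => ⟨0, by omega⟩
  refine (nrtK_le_fintype_card _ (exists_coveringWord_nrtDist_le (t := t) e z)).trans_eq ?_
  have hV : Fintype.card {a : Fin k → Fin q // a ≠ z} = q ^ k - 1 := by
    simp [Fintype.card_subtype_compl]
  rw [Fintype.card_prod, Fintype.card_sum, Fintype.card_prod, hV]
  simp only [Fintype.card_pi, Fintype.card_fin, Finset.prod_const, Finset.card_univ]
  obtain ⟨r, hr⟩ : ∃ r, q ^ k = r + 1 :=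
    Nat.exists_eq_add_of_le' (Nat.pow_pos (by omega : 0 < q))
  rw [pow_mul, pow_mul, hr, Nat.add_sub_cancel, Nat.add_sub_cancel]
  refine (Nat.sub_eq_of_eq_add ?_).symm
  ring
end

section
/- Let q, s, k be integers with q ≥ 2, s ≥ 3, and k ≥ 1. Then K_q(2k+1, s, (k+1)s) ≤ q^{ks} − q^{k(s−2)}·(q^k − 1). -/
/-- If `x` and `y` agree in block `i` from position `d i` on, then their NRT distance is at most
`∑ i, d i`. -/
lemma nrtDist_le_sum {m s q : ℕ} (x y : Fin m × Fin s → Fin q) (d : Fin m → ℕ)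
    (h : ∀ i b, x (i, b) ≠ y (i, b) → b.val < d i) : nrtDist m s q x y ≤ ∑ i, d i := by
  unfold nrtDist
  calc _ ≤ (Finset.univ.sigma fun i : Fin m => Finset.range (d i)).card := by
        refine Finset.card_le_card_of_injOn (fun c => ⟨c.1, c.2.val⟩) ?_ ?_
        · rintro ⟨i, a⟩ hc
          simp only [Finset.coe_filter, Finset.mem_univ, true_and, Set.mem_ofPred_eq] at hc
          obtain ⟨b, hab, hb⟩ := hc
          simpa using lt_of_le_of_lt (Fin.le_def.mp hab) (h i b hb)
        · rintro ⟨i, a⟩ - ⟨j, b⟩ - hij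
          simp only [Sigma.mk.injEq, heq_eq_eq] at hij
          exact Prod.ext hij.1 (Fin.ext hij.2)
    _ = ∑ i, d i := by simp

/-- The word of `2k + 1` blocks whose first `k` blocks are those of `u`, and whose remaining blocks
vanish except for their top entries, which repeat the bottom entries of `u` cyclically. -/
def nrtEncode {q n k : ℕ} [NeZero q] [NeZero k] (u : Fin k × Fin (n + 2) → Fin q) :
    Fin (2 * k + 1) × Fin (n + 2) → Fin q := fun c =>
  if c.1.val < k then u (Fin.ofNat k c.1.val, c.2)
  else if c.2 = Fin.last (n + 1) then u (Fin.ofNat k c.1.val, 0) else 0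

/-- The words whose bottom entries all vanish, but whose entries in the position above do not. -/
def nrtRemoved (q n k : ℕ) [NeZero q] : Finset (Fin k × Fin (n + 2) → Fin q) :=
  Finset.univ.filter fun u => (∀ i, u (i, 0) = 0) ∧ ∃ i, u (i, 1) ≠ 0

lemma card_nrtRemoved (q n k : ℕ) [NeZero q] :
    (nrtRemoved q n k).card = q ^ (k * n) * (q ^ k - 1) := by
  let A : Finset (Fin k × Fin (n + 2) → Fin q) :=
    Fintype.piFinset fun c => if c.2 = 0 then {0} else Finset.univ
  let B : Finset (Fin k × Fin (n + 2) → Fin q) :=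
    Fintype.piFinset fun c => if c.2 = 0 ∨ c.2 = 1 then {0} else Finset.univ
  have hA : A.card = q ^ (k * n) * q ^ k := by
    simp only [A, Fintype.card_piFinset, Fintype.prod_prod_type, Fin.prod_univ_succ]
    simp [Fin.succ_ne_zero]
    ring
  have hB : B.card = q ^ (k * n) := by
    simp only [B, Fintype.card_piFinset, Fintype.prod_prod_type, Fin.prod_univ_succ]
    have h1 (x : Fin n) : x.succ.succ ≠ 1 := by simp [Fin.ext_iff]
    simp [Fin.succ_ne_zero, h1]
    ring
  have hBA : B ⊆ A := by
    intro u hu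
    simp only [A, B, Fintype.mem_piFinset] at hu ⊢
    intro c
    by_cases hc : c.2 = 0
    · simpa [hc] using hu c
    · simp [hc]
  have hR : nrtRemoved q n k = A \ B := by
    have hmA (u) : u ∈ A ↔ ∀ i, u (i, 0) = 0 := by
      simp only [A, Fintype.mem_piFinset]
      refine ⟨fun h i => by simpa using h (i, 0), fun h c => ?_⟩
      obtain ⟨i, a⟩ := c
      by_cases ha : a = 0
      · subst ha; simpa using h i
      · simp [ha]
    have hmB (u) : u ∈ B ↔ (∀ i, u (i, 0) = 0) ∧ ∀ i, u (i, 1) = 0 := by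
      simp only [B, Fintype.mem_piFinset]
      refine ⟨fun h => ⟨fun i => by simpa using h (i, 0), fun i => by simpa using h (i, 1)⟩,
        fun h c => ?_⟩
      obtain ⟨i, a⟩ := c
      by_cases ha : a = 0
      · subst ha; simpa using h.1 i
      by_cases ha1 : a = 1
      · subst ha1; simpa using h.2 i
      · simp [ha, ha1]
    ext u
    simp only [nrtRemoved, Finset.mem_filter, Finset.mem_univ, true_and, Finset.mem_sdiff, hmA, hmB]
    push Not
    tauto
  rw [hR, Finset.card_sdiff_of_subset hBA, hA, hB, Nat.mul_sub, mul_one]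

lemma sum_ite_val_lt (k s : ℕ) :
    ∑ i : Fin (2 * k + 1), (if i.val < k then 0 else s) = (k + 1) * s := by
  rw [Fin.sum_univ_eq_sum_range (fun i => if i < k then 0 else s),
    show 2 * k + 1 = k + (k + 1) by ring, Finset.sum_range_add,
    Finset.sum_eq_zero fun i hi => if_pos (Finset.mem_range.mp hi)]
  simp

/-- Restriction of a word to its first `k` blocks. -/
def nrtHead {q s k : ℕ} (x : Fin (2 * k + 1) × Fin s → Fin q) : Fin k × Fin s → Fin q :=
  fun c => x (c.1.castLE (by omega), c.2)

lemma nrtHead_ofNat {q s k : ℕ} [NeZero k] (x : Fin (2 * k + 1) × Fin s → Fin q)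
    {i : Fin (2 * k + 1)} (hi : i.val < k) (b : Fin s) :
    nrtHead x (Fin.ofNat k i.val, b) = x (i, b) := by
  unfold nrtHead
  congr 2
  ext
  simp [Nat.mod_eq_of_lt hi]

lemma nrtDist_nrtEncode_head_le {q n k : ℕ} [NeZero q] [NeZero k]
    (x : Fin (2 * k + 1) × Fin (n + 2) → Fin q) :
    nrtDist _ _ q x (nrtEncode (nrtHead x)) ≤ (k + 1) * (n + 2) := by
  refine (nrtDist_le_sum _ _ _ fun i b h => ?_).trans_eq (sum_ite_val_lt k (n + 2))
  by_cases hi : i.val < k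
  · simp [nrtEncode, hi, nrtHead_ofNat x hi, -Fin.ofNat_eq_cast] at h
  · simp [hi]

/-- Changing one bottom entry of the first `k` blocks keeps the encoding within the covering radius,
provided that one of the top entries of the last blocks then agrees. -/
lemma nrtDist_nrtEncode_update_le {q n k : ℕ} [NeZero q] [NeZero k]
    (x : Fin (2 * k + 1) × Fin (n + 2) → Fin q) (p : Fin k) (t : Fin q) (r : Fin (2 * k + 1))
    (hr : k ≤ r.val)
    (hx : Function.update (nrtHead x) (p, 0) t (Fin.ofNat k r.val, 0) = x (r, Fin.last (n + 1))) :
    nrtDist _ _ q x (nrtEncode (Function.update (nrtHead x) (p, 0) t)) ≤ (k + 1) * (n + 2) := by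
  let p' : Fin (2 * k + 1) := p.castLE (by omega)
  let d : Fin (2 * k + 1) → ℕ := fun i =>
    if i = p' then 1 else if i.val < k then 0 else if i = r then n + 1 else n + 2
  have hd : ∑ i, d i ≤ (k + 1) * (n + 2) := by
    have h : ∑ i, (d i + if i = r then 1 else 0) =
        ∑ i : Fin (2 * k + 1), ((if i = p' then 1 else 0) + if i.val < k then 0 else n + 2) := by
      refine Finset.sum_congr rfl fun i _ => ?_
      have hp : p'.val < k := p.isLt
      simp only [d, Fin.ext_iff]
      split_ifs <;> omega
    rw [Finset.sum_add_distrib, Finset.sum_add_distrib, sum_ite_val_lt] at h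
    simp only [Finset.sum_ite_eq', Finset.mem_univ, if_true] at h
    omega
  refine (nrtDist_le_sum _ _ d fun i b h => ?_).trans hd
  by_cases hi : i.val < k
  · by_cases hb : (Fin.ofNat k i.val, b) = (p, (0 : Fin (n + 2)))
    · obtain ⟨h1, h2⟩ := Prod.mk.inj hb
      have : i = p' := by
        ext
        simpa [p', Nat.mod_eq_of_lt hi] using congrArg Fin.val h1
      simp [d, this, h2]
    · simp [nrtEncode, hi, Function.update_of_ne hb, nrtHead_ofNat x hi, -Fin.ofNat_eq_cast] at h
  · have hp : i ≠ p' := fun h => hi (h ▸ p.isLt)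
    by_cases hir : i = r
    · subst hir
      have hb : b ≠ Fin.last (n + 1) := by
        rintro rfl
        simp [nrtEncode, hi, hx, -Fin.ofNat_eq_cast] at h
      simpa [d, hp, hi] using Fin.val_lt_last hb
    · simp [d, hp, hi, hir]

lemma exists_nrtDist_nrtEncode_le {q n k : ℕ} [NeZero q] [NeZero k] (hq : 2 ≤ q)
    (x : Fin (2 * k + 1) × Fin (n + 2) → Fin q) :
    ∃ u ∉ nrtRemoved q n k, nrtDist _ _ q x (nrtEncode u) ≤ (k + 1) * (n + 2) := by
  have hk : 0 < k := NeZero.pos k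
  by_cases hR : nrtHead x ∈ nrtRemoved q n k
  swap
  · exact ⟨_, hR, nrtDist_nrtEncode_head_le x⟩
  have hu (p : Fin k) (t : Fin q) (ht : t ≠ 0) :
      Function.update (nrtHead x) (p, 0) t ∉ nrtRemoved q n k := by
    intro h
    have := (Finset.mem_filter.mp h).2.1 p
    simp [ht] at this
  have h0 := (Finset.mem_filter.mp hR).2.1
  by_cases hT : ∃ r : Fin (2 * k + 1), k ≤ r.val ∧ x (r, Fin.last (n + 1)) ≠ 0
  · obtain ⟨r, hr, hxr⟩ := hT
    exact ⟨_, hu (Fin.ofNat k r.val) _ hxr, nrtDist_nrtEncode_update_le x _ _ r hr (by simp)⟩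
  push Not at hT
  obtain hk2 | rfl : 2 ≤ k ∨ k = 1 := by omega
  · refine ⟨_, hu ⟨0, hk⟩ ⟨1, hq⟩ (by simp [Fin.ext_iff]),
      nrtDist_nrtEncode_update_le x _ _ ⟨k + 1, by omega⟩ (by simp) ?_⟩
    rw [Function.update_of_ne, h0, hT _ (by simp)]
    simp [Fin.ext_iff, Nat.mod_eq_of_lt hk2]
  · refine ⟨fun c => if c.2.val < 2 then 0 else nrtHead x c, ?_, ?_⟩
    · simp [nrtRemoved]
    · refine (nrtDist_le_sum _ _ (fun i => if i.val < 1 then 2 else n + 1) fun i b h => ?_).trans ?_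
      · by_cases hi : i.val < 1
        · have hb : b.val < 2 := by
            by_contra hb
            simp only [nrtEncode, hi, hb, if_true, if_false, nrtHead_ofNat x hi] at h
            exact h rfl
          simpa [hi] using hb
        · have hb : b ≠ Fin.last (n + 1) := by
            rintro rfl
            rw [hT i (by omega)] at h
            simp only [nrtEncode, hi, if_false] at h
            simp at h
          simpa [hi] using Fin.val_lt_last hb
      · rw [Fin.sum_univ_three]
        simp
        omega

/-- `K_q(2k+1, s, (k+1)s) ≤ q^{ks} - q^{k(s-2)}(q^k - 1)`. -/
theorem stmt_16 (q s k : ℕ) (hq : 2 ≤ q) (hs : 3 ≤ s) (hk : 1 ≤ k) :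
    nrtK q (2 * k + 1) s ((k + 1) * s) ≤ q ^ (k * s) - q ^ (k * (s - 2)) * (q ^ k - 1) := by
  obtain ⟨n, rfl⟩ : ∃ n, s = n + 2 := ⟨s - 2, by omega⟩
  have : NeZero q := ⟨by omega⟩
  have : NeZero k := ⟨by omega⟩
  let C := (nrtRemoved q n k)ᶜ.image nrtEncode
  have hC : nrtK q (2 * k + 1) (n + 2) ((k + 1) * (n + 2)) ≤ C.card := by
    refine Nat.sInf_le ⟨C, rfl, fun x => ?_⟩
    obtain ⟨u, hu, hd⟩ := exists_nrtDist_nrtEncode_le hq x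
    exact ⟨_, Finset.mem_image_of_mem _ (Finset.mem_compl.mpr hu), hd⟩
  refine (hC.trans Finset.card_image_le).trans_eq ?_
  rw [Finset.card_compl, card_nrtRemoved]
  simp
end

section
/- Let v be a prime power, and let q ≥ 2 and s ≥ 3 be integers. Then K_{vq}(3, s, 2s−1) ≤ v^{s+1}·(q^{s+1} − q^{s−1}·(q−1)), and K_{vq}(2, s, s) ≤ v^{s}·(q^{s} − q^{s−2}·(q−1)). -/
open Polynomial in
/-- Over a nontrivial commutative ring, a polynomial of degree less than `n` can be prescribed by `d₀`
coefficients at `0`, `d₁` coefficients at infinity and `d₂` Taylor coefficients at `1`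
whenever `d₀ + d₁ + d₂ = n`. -/
theorem exists_polynomial_prescribed_at_three_points {R : Type*} [CommRing R] [Nontrivial R]
    {n d₀ d₁ d₂ : ℕ} (hd : d₀ + d₁ + d₂ = n) (x y z : ℕ → R) :
    ∃ p : R[X], p.degree < n ∧ (∀ b < d₀, p.coeff b = x b) ∧
      (∀ b < d₁, p.coeff (n - 1 - b) = y b) ∧ ∀ b < d₂, (taylor 1 p).coeff b = z b := by
  let h : ℕ → R := fun i => if i < d₀ then x i else if n - d₁ ≤ i then y (n - 1 - i) else 0
  let l : R[X] := ∑ i ∈ Finset.range n, C (h i) * X ^ i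
  let t : R[X] := ∑ i ∈ Finset.range d₂, C (z i) * (X - C 1) ^ i
  have l_coeff : ∀ b < n, l.coeff b = h b := by
    intro b hb
    simp [l, finsetSum_coeff, coeff_C_mul, coeff_X_pow, hb]
  have l_degree : l.degree < n := by
    rw [degree_lt_iff_coeff_zero]
    intro b hb
    simp only [l, finsetSum_coeff, coeff_C_mul, coeff_X_pow]
    refine Finset.sum_eq_zero fun i hi => ?_
    rw [if_neg (by have := Finset.mem_range.1 hi; omega), mul_zero]
  have monic_sub : ((X - C 1 : R[X]) ^ d₂).Monic := (monic_X_sub_C 1).pow _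
  obtain ⟨u, w, huw⟩ : IsCoprime ((X : R[X]) ^ d₀) ((X - C 1) ^ d₂) :=
    IsCoprime.pow ⟨1, -1, by simp⟩
  let g : R[X] := (u * (t - l)) %ₘ ((X - C 1) ^ d₂)
  have g_degree : g.degree < d₂ := by
    refine (degree_modByMonic_lt _ monic_sub).trans_eq ?_
    rw [degree_pow' (by rw [leadingCoeff_X_sub_C]; simp), degree_X_sub_C]
    simp
  have g_coeff : ∀ b, d₂ ≤ b → g.coeff b = 0 := degree_lt_iff_coeff_zero _ _ |>.1 g_degree
  have l_add_coeff : ∀ b, b < d₀ ∨ d₀ + d₂ ≤ b → (l + X ^ d₀ * g).coeff b = l.coeff b := by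
    intro b hb
    rw [coeff_add, coeff_X_pow_mul']
    split_ifs with hle
    · rw [g_coeff _ (by omega), add_zero]
    · rw [add_zero]
  refine ⟨l + X ^ d₀ * g, ?_, ?_, ?_, ?_⟩
  · rw [degree_lt_iff_coeff_zero] at l_degree ⊢
    intro b hb
    rw [l_add_coeff b (by omega), l_degree b hb]
  · intro b hb
    rw [l_add_coeff b (by omega), l_coeff b (by omega)]
    simp [h, hb]
  · intro b hb
    rw [l_add_coeff _ (by omega), l_coeff _ (by omega)]
    simp only [h]
    rw [if_neg (by omega), if_pos (by omega)]
    congr 1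
    omega
  · intro b hb
    have congr_t : ∃ r, l + X ^ d₀ * g = t + (X - C 1) ^ d₂ * r := by
      refine ⟨-(w * (t - l)) - X ^ d₀ * ((u * (t - l)) /ₘ ((X - C 1) ^ d₂)), ?_⟩
      have hg := modByMonic_add_div (u * (t - l)) ((X - C 1 : R[X]) ^ d₂)
      simp only [g]
      linear_combination X ^ d₀ * hg + (t - l) * huw
    obtain ⟨r, hr⟩ := congr_t
    have taylor_sub : taylor 1 (X - C 1 : R[X]) = X := by simp
    rw [hr, map_add, taylor_mul, taylor_pow, taylor_sub, coeff_add, coeff_X_pow_mul',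
      if_neg (by omega), add_zero]
    simp only [t, map_sum, taylor_mul, taylor_pow, taylor_sub, taylor_C, finsetSum_coeff,
      coeff_C_mul, coeff_X_pow]
    simp [hb]

/-- The words of `c` cover all `m`-tuples of sequences over `α`: every tuple shares with some
word of `c` prefixes of lengths at most `s` adding up to `k`. -/
def IsPrefixCover {ι α : Type*} {m : ℕ} (s k : ℕ) (c : ι → Fin m → ℕ → α) : Prop :=
  ∀ x : Fin m → ℕ → α, ∃ i, ∃ a : Fin m → ℕ,
    (∀ j, a j ≤ s) ∧ ∑ j, a j = k ∧ ∀ j, ∀ b < a j, x j b = c i j b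

/-- For any prescribed prefix lengths adding up to `k`, every `m`-tuple of sequences shares
prefixes of exactly these lengths with some word of `c`. -/
def IsPrefixArray {ι α : Type*} {m : ℕ} (k : ℕ) (c : ι → Fin m → ℕ → α) : Prop :=
  ∀ a : Fin m → ℕ, ∑ j, a j = k → ∀ x : Fin m → ℕ → α, ∃ i, ∀ j, ∀ b < a j, x j b = c i j b

theorem IsPrefixCover.prod {ι κ α β : Type*} {m s k : ℕ} {c : ι → Fin m → ℕ → α}
    {d : κ → Fin m → ℕ → β} (hc : IsPrefixCover s k c) (hd : IsPrefixArray k d) :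
    IsPrefixCover s k fun (i : κ × ι) j b => (d i.1 j b, c i.2 j b) := by
  intro x
  obtain ⟨i, a, has, hak, hi⟩ := hc fun j b => (x j b).2
  obtain ⟨i', hi'⟩ := hd a hak fun j b => (x j b).1
  exact ⟨(i', i), a, has, hak, fun j b hb => Prod.ext (hi' j b hb) (hi j b hb)⟩

theorem IsPrefixCover.exists_succ {ι α : Type*} {m s k : ℕ} {c : ι → Fin (m + 1) → ℕ → α}
    (hc : IsPrefixCover s k c) :
    ∃ d : α × ι → Fin (m + 1) → ℕ → α, IsPrefixCover (s + 1) (k + 1) d := by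
  refine ⟨fun i => Fin.cons (fun b => Nat.casesOn b i.1 (c i.2 0)) fun j => c i.2 j.succ, ?_⟩
  intro x
  obtain ⟨i, a, has, hak, hi⟩ := hc (Fin.cons (fun b => x 0 (b + 1)) fun j => x j.succ)
  refine ⟨(x 0 0, i), Fin.cons (a 0 + 1) fun j => a j.succ, ?_, ?_, ?_⟩
  · refine Fin.cases ?_ fun j => ?_
    · simpa using has 0
    · simpa using (has j.succ).trans (Nat.le_succ s)
  · rw [Fin.sum_univ_succ] at hak ⊢
    simp only [Fin.cons_zero, Fin.cons_succ]
    omega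
  · refine Fin.cases ?_ fun j => ?_
    · rintro (_ | b) hb
      · rfl
      · exact hi 0 b (by simpa using hb)
    · exact hi j.succ

theorem IsPrefixCover.exists_iterate {ι α : Type} [Fintype ι] [Fintype α] {m s k : ℕ}
    {c : ι → Fin (m + 1) → ℕ → α} (hc : IsPrefixCover s k c) (r : ℕ) :
    ∃ d : Fin (Fintype.card α ^ r * Fintype.card ι) → Fin (m + 1) → ℕ → α,
      IsPrefixCover (s + r) (k + r) d := by
  have reindex : ∀ {κ κ' : Type} (e : κ' ≃ κ) {s k : ℕ} {c : κ → Fin (m + 1) → ℕ → α},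
      IsPrefixCover s k c → IsPrefixCover s k (c ∘ e) := by
    intro κ κ' e s k c hc x
    obtain ⟨i, h⟩ := hc x
    exact ⟨e.symm i, by simpa using h⟩
  induction r with
  | zero => exact ⟨_, reindex (Fintype.equivOfCardEq (by simp)) hc⟩
  | succ r ih =>
    obtain ⟨d, hd⟩ := ih
    obtain ⟨d', hd'⟩ := hd.exists_succ
    refine ⟨_, reindex (Fintype.equivOfCardEq ?_) hd'⟩
    simp only [Fintype.card_fin, Fintype.card_prod]
    ring

theorem IsPrefixCover.nrtK_le {ι α : Type*} [Fintype ι] [Fintype α] {m s k q : ℕ}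
    {c : ι → Fin m → ℕ → α} (hc : IsPrefixCover s k c) (hα : Fintype.card α = q) (hs : 0 < s) :
    nrtK q m s (m * s - k) ≤ Fintype.card ι := by
  classical
  let e : α ≃ Fin q := Fintype.equivFinOfCardEq hα
  let C : Finset (Fin m × Fin s → Fin q) :=
    Finset.univ.image fun i p => e (c i p.1 (s - 1 - p.2))
  suffices hC : ∀ x, ∃ y ∈ C, nrtDist m s q x y ≤ m * s - k from
    le_trans (Nat.sInf_le ⟨C, rfl, hC⟩) Finset.card_image_le
  intro x
  obtain ⟨i, a, has, hak, hi⟩ := hc fun j b => e.symm (x (j, ⟨s - 1 - b, by omega⟩))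
  refine ⟨_, Finset.mem_image_of_mem _ (Finset.mem_univ i), ?_⟩
  have agree : ∀ (j : Fin m) (b : Fin s), s - a j ≤ b → x (j, b) = e (c i j (s - 1 - b)) := by
    intro j b hb
    have := b.isLt
    have h := hi j (s - 1 - b) (by omega)
    rw [Equiv.symm_apply_eq] at h
    rw [← h]
    congr 2
    exact Fin.ext (by dsimp only; omega)
  calc nrtDist m s q x _
      ≤ (Finset.univ.filter fun p : Fin m × Fin s => (p.2 : ℕ) < s - a p.1).card := by
        refine Finset.card_le_card fun p hp => ?_
        simp only [Finset.mem_filter, Finset.mem_univ, true_and] at hp ⊢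
        obtain ⟨b, hpb, hb⟩ := hp
        by_contra hlt
        have hpb' : (p.2 : ℕ) ≤ b := hpb
        exact hb (agree p.1 b (by omega))
    _ = ∑ j, (s - a j) := by
        rw [Finset.card_filter, Fintype.sum_prod_type]
        refine Finset.sum_congr rfl fun j _ => ?_
        rw [← Finset.card_filter]
        dsimp only
        rw [Fin.card_filter_val_lt]
        omega
    _ = m * s - k := by
        rw [Finset.sum_tsub_distrib _ fun j _ => has j, hak]
        simp

theorem isPrefixArray_three {R : Type*} [CommRing R] [Nontrivial R] (k : ℕ) :
    IsPrefixArray k fun (f : Fin k → R) (j : Fin 3) (b : ℕ) =>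
      let p := ((Polynomial.degreeLTEquiv R k).symm f : Polynomial R)
      (![p.coeff b, p.coeff (k - 1 - b), (Polynomial.taylor 1 p).coeff b] : Fin 3 → R) j := by
  intro a ha x
  rw [Fin.sum_univ_three] at ha
  obtain ⟨p, hp, h₀, h₁, h₂⟩ :=
    exists_polynomial_prescribed_at_three_points ha (x 0) (x 1) (x 2)
  refine ⟨Polynomial.degreeLTEquiv R k ⟨p, Polynomial.mem_degreeLT.2 hp⟩, ?_⟩
  simp only [LinearEquiv.symm_apply_apply]
  intro j b hb
  fin_cases j
  · exact (h₀ b hb).symm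
  · exact (h₁ b hb).symm
  · exact (h₂ b hb).symm

theorem IsPrefixArray.castSucc {ι α : Type*} [Nonempty α] {m k : ℕ} {c : ι → Fin (m + 1) → ℕ → α}
    (hc : IsPrefixArray k c) : IsPrefixArray k fun i (j : Fin m) => c i j.castSucc := by
  intro a ha x
  obtain ⟨i, hi⟩ := hc (Fin.snoc a 0) (by simp [Fin.sum_univ_castSucc, ha])
    (Fin.snoc (α := fun _ => ℕ → α) x fun _ => Classical.arbitrary α)
  exact ⟨i, fun j b hb => by simpa using hi j.castSucc b (by simpa using hb)⟩

/-- The words of a prefix cover of pairs of sequences over `Fin (n + 1)` by prefixes of total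
length two. -/
def pairCover (n : ℕ) : Fin (n + 1) ⊕ Fin n × Fin n → Fin 2 → ℕ → Fin (n + 1)
  | .inl i, _, b => if b = 0 then 0 else i
  | .inr (i, j), t, _ => ![i.succ, j.succ] t

theorem isPrefixCover_pairCover (n : ℕ) : IsPrefixCover 2 2 (pairCover n) := by
  intro x
  have two : ∀ t, x t 0 = 0 → ∀ b < 2, x t b = pairCover n (.inl (x t 1)) t b := by
    intro t ht b hb
    interval_cases b <;> simp [pairCover, ht]
  by_cases h₀ : x 0 0 = 0
  · refine ⟨.inl (x 0 1), ![2, 0], by simp [Fin.forall_fin_two], by simp, ?_⟩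
    simpa [Fin.forall_fin_two] using two 0 h₀
  by_cases h₁ : x 1 0 = 0
  · refine ⟨.inl (x 1 1), ![0, 2], by simp [Fin.forall_fin_two], by simp, ?_⟩
    simpa [Fin.forall_fin_two] using two 1 h₁
  · refine ⟨.inr ((x 0 0).pred h₀, (x 1 0).pred h₁), ![1, 1], by simp [Fin.forall_fin_two],
      by simp, ?_⟩
    simp [Fin.forall_fin_two, pairCover]

/-- The words of a prefix cover of triples of sequences over `Fin (n + 2)` by two prefixes of
length one. -/
def tripleCover (n : ℕ) : Option (Fin (n + 1) × Fin (n + 1)) → Fin 3 → ℕ → Fin (n + 2)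
  | none, _, _ => 0
  | some (i, j), t, _ => ![i.succ, j.succ, (i + j).succ] t

theorem isPrefixCover_tripleCover (n : ℕ) : IsPrefixCover 1 2 (tripleCover n) := by
  intro x
  rcases Fin.eq_zero_or_eq_succ (x 0 0) with h₀ | ⟨i, h₀⟩ <;>
  rcases Fin.eq_zero_or_eq_succ (x 1 0) with h₁ | ⟨j, h₁⟩ <;>
  rcases Fin.eq_zero_or_eq_succ (x 2 0) with h₂ | ⟨l, h₂⟩
  case inl.inl.inl | inl.inl.inr =>
    exact ⟨none, ![1, 1, 0], by simp [Fin.forall_fin_succ], by simp [Fin.sum_univ_three],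
      by simp [Fin.forall_fin_succ, tripleCover, h₀, h₁]⟩
  case inl.inr.inl =>
    exact ⟨none, ![1, 0, 1], by simp [Fin.forall_fin_succ], by simp [Fin.sum_univ_three],
      by simp [Fin.forall_fin_succ, tripleCover, h₀, h₂]⟩
  case inr.inl.inl =>
    exact ⟨none, ![0, 1, 1], by simp [Fin.forall_fin_succ], by simp [Fin.sum_univ_three],
      by simp [Fin.forall_fin_succ, tripleCover, h₁, h₂]⟩
  case inl.inr.inr =>
    exact ⟨some (l - j, j), ![0, 1, 1], by simp [Fin.forall_fin_succ],
      by simp [Fin.sum_univ_three], by simp [Fin.forall_fin_succ, tripleCover, h₁, h₂]⟩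
  case inr.inl.inr =>
    exact ⟨some (i, l - i), ![1, 0, 1], by simp [Fin.forall_fin_succ],
      by simp [Fin.sum_univ_three], by simp [Fin.forall_fin_succ, tripleCover, h₀, h₂]⟩
  all_goals
    exact ⟨some (i, j), ![1, 1, 0], by simp [Fin.forall_fin_succ],
      by simp [Fin.sum_univ_three], by simp [Fin.forall_fin_succ, tripleCover, h₀, h₁]⟩

theorem nrtK_mul_le {v q m s k r s' k' R n : ℕ} [NeZero v] {ι : Type} [Fintype ι]
    {c : ι → Fin (m + 1) → ℕ → Fin q} (hc : IsPrefixCover s k c)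
    {d : (Fin k' → ZMod v) → Fin (m + 1) → ℕ → ZMod v} (hd : IsPrefixArray k' d)
    (hs : s + r = s') (hk : k + r = k') (hR : (m + 1) * s' - k' = R) (hs' : 0 < s')
    (hn : q ^ r * Fintype.card ι ≤ n) :
    nrtK (v * q) (m + 1) s' R ≤ v ^ k' * n := by
  subst hs hk hR
  obtain ⟨c', hc'⟩ := hc.exists_iterate r
  refine ((hc'.prod hd).nrtK_le (by simp [ZMod.card]) hs').trans ?_
  simpa [ZMod.card] using Nat.mul_le_mul_left _ hn

/-- For `v` a prime power, `q ≥ 2`, `s ≥ 3`: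
`K_{vq}(3, s, 2s-1) ≤ v^{s+1}(q^{s+1} - q^{s-1}(q-1))` and
`K_{vq}(2, s, s) ≤ v^{s}(q^{s} - q^{s-2}(q-1))`. -/
theorem stmt_19 (v q s : ℕ) (hv : IsPrimePow v) (hq : 2 ≤ q) (hs : 3 ≤ s) :
    nrtK (v * q) 3 s (2 * s - 1) ≤ v ^ (s + 1) * (q ^ (s + 1) - q ^ (s - 1) * (q - 1)) ∧
    nrtK (v * q) 2 s s ≤ v ^ s * (q ^ s - q ^ (s - 2) * (q - 1)) := by
  have : Fact (1 < v) := ⟨hv.one_lt⟩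
  have : NeZero v := ⟨by have := hv.one_lt; omega⟩
  obtain ⟨n, rfl⟩ := Nat.exists_eq_add_of_le' hq
  obtain ⟨r, rfl⟩ := Nat.exists_eq_add_of_le' hs
  constructor
  · refine nrtK_mul_le (isPrefixCover_tripleCover n) (isPrefixArray_three (r + 4))
      (r := r + 2) (by omega) (by omega) (by omega) (by omega) (Nat.le_sub_of_add_le ?_)
    rw [show r + 3 + 1 = r + 2 + 2 by rfl, pow_add _ (r + 2) 2, show r + 3 - 1 = r + 2 by rfl,
      show n + 2 - 1 = n + 1 by rfl, ← mul_add]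
    refine Nat.mul_le_mul_left _ ?_
    simp only [Fintype.card_option, Fintype.card_prod, Fintype.card_fin]
    nlinarith
  · refine nrtK_mul_le (isPrefixCover_pairCover (n + 1)) (isPrefixArray_three (r + 3)).castSucc
      (r := r + 1) (by omega) (by omega) (by omega) (by omega) (Nat.le_sub_of_add_le ?_)
    rw [show r + 3 = r + 1 + 2 by rfl, pow_add _ (r + 1) 2, Nat.add_sub_cancel,
      show n + 2 - 1 = n + 1 by rfl, ← mul_add]
    refine Nat.mul_le_mul_left _ ?_
    simp only [Fintype.card_sum, Fintype.card_prod, Fintype.card_fin]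
    nlinarith
end
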